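/- arXiv:1810.02423 — 9 statements merged into one kernel-verified Lean document; each statement's English description precedes it below -/
import Mathlib

section
/- Every admissible u×v real matrix M converges under Sinkhorn iteration: the sequences L^k and T^k produced by alternately row-normalizing and column-normalizing M converge (entrywise) to a pair of matrices (L, T) that is stable. -/
open Matrix Filter

/-- A matrix is admissible if it has nonnegative entries and no zero row or column. -/
def Admissible {u v : ℕ} (M : Matrix (Fin u) (Fin v) ℝ) : Prop :=
  (∀ i j, 0 ≤ M i j) ∧ (∀ i, ∃ j, M i j ≠ 0) ∧ (∀ j, ∃ i, M i j ≠ 0)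

/-- Row normalization. -/
noncomputable def rowNorm {u v : ℕ} (A : Matrix (Fin u) (Fin v) ℝ) : Matrix (Fin u) (Fin v) ℝ :=
  Matrix.of fun i j => A i j / ∑ k, A i k

/-- Column normalization. -/
noncomputable def colNorm {u v : ℕ} (A : Matrix (Fin u) (Fin v) ℝ) : Matrix (Fin u) (Fin v) ℝ :=
  Matrix.of fun i j => A i j / ∑ k, A k j

/-- A pair (P,Q) is stable if C(P) = Q and R(Q) = P. -/
def Stable {u v : ℕ} (P Q : Matrix (Fin u) (Fin v) ℝ) : Prop :=
  colNorm P = Q ∧ rowNorm Q = P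

/-- The row-normalized Sinkhorn iterates: `skL M 0 = R(M)`, `skL M (k+1) = R(C(skL M k))`. -/
noncomputable def skL {u v : ℕ} (M : Matrix (Fin u) (Fin v) ℝ) : ℕ → Matrix (Fin u) (Fin v) ℝ
  | 0 => rowNorm M
  | k + 1 => rowNorm (colNorm (skL M k))

/-- The column-normalized Sinkhorn iterates: `skT M k = C(skL M k)`. -/
noncomputable def skT {u v : ℕ} (M : Matrix (Fin u) (Fin v) ℝ) (k : ℕ) : Matrix (Fin u) (Fin v) ℝ :=
  colNorm (skL M k)

/-- Entrywise convergence of a sequence of matrices. -/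
def EntrywiseLimit {u v : ℕ} (f : ℕ → Matrix (Fin u) (Fin v) ℝ)
    (L : Matrix (Fin u) (Fin v) ℝ) : Prop :=
  ∀ i j, Filter.Tendsto (fun k => f k i j) Filter.atTop (nhds (L i j))

/-- `PartialPattern B A` means `B ≺ A` : every zero of `A` is a zero of `B`. -/
def PartialPattern {u v : ℕ} (B A : Matrix (Fin u) (Fin v) ℝ) : Prop :=
  ∀ i j, A i j = 0 → B i j = 0

/-- Product of the diagonal of `A` determined by the permutation `σ`. -/
noncomputable def diagProd {n : ℕ} (A : Matrix (Fin n) (Fin n) ℝ) (σ : Equiv.Perm (Fin n)) : ℝ :=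
  ∏ i, A i (σ i)

/-- `A` has at least one positive diagonal. -/
def HasPosDiag {n : ℕ} (A : Matrix (Fin n) (Fin n) ℝ) : Prop :=
  ∃ σ : Equiv.Perm (Fin n), ∀ i, 0 < A i (σ i)

/-- The entry at position `(i,j)` is contained in some positive diagonal of `A`. -/
def OnDiag {n : ℕ} (A : Matrix (Fin n) (Fin n) ℝ) (i j : Fin n) : Prop :=
  ∃ σ : Equiv.Perm (Fin n), (∀ k, 0 < A k (σ k)) ∧ σ i = j

/-- `A` has total support : every positive entry is on-diagonal. -/
def TotalSupport {n : ℕ} (A : Matrix (Fin n) (Fin n) ℝ) : Prop :=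
  ∀ i j, 0 < A i j → OnDiag A i j

/-- Doubly stochastic matrices. -/
def DoublyStochastic {n : ℕ} (A : Matrix (Fin n) (Fin n) ℝ) : Prop :=
  (∀ i j, 0 ≤ A i j) ∧ (∀ i, ∑ j, A i j = 1) ∧ (∀ j, ∑ i, A i j = 1)

/-- Cross ratio equivalence of square matrices. -/
def CrossRatioEquiv {n : ℕ} (A B : Matrix (Fin n) (Fin n) ℝ) : Prop :=
  (∀ σ : Equiv.Perm (Fin n), diagProd A σ ≠ 0 ↔ diagProd B σ ≠ 0) ∧
  ∀ σ σ' : Equiv.Perm (Fin n), diagProd A σ ≠ 0 → diagProd A σ' ≠ 0 →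
    diagProd A σ / diagProd A σ' = diagProd B σ / diagProd B σ'


lemma scalar_conv (x : ℕ → ℝ) (S : ℝ) (hS : ∀ k, |x k| ≤ S) (p : Polynomial ℝ) (hp : p ≠ 0)
    (h0 : Tendsto (fun k => p.eval (x k)) atTop (nhds 0))
    (h1 : Tendsto (fun k => x (k+1) - x k) atTop (nhds 0)) :
    ∃ l, Tendsto x atTop (nhds l) := by
  have hb1 : IsBoundedUnder (· ≤ ·) atTop x :=
    isBoundedUnder_of ⟨S, fun k => (abs_le.1 (hS k)).2⟩
  have hb2 : IsBoundedUnder (· ≥ ·) atTop x :=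
    isBoundedUnder_of ⟨-S, fun k => (abs_le.1 (hS k)).1⟩
  refine tendsto_of_no_upcrossings dense_univ ?_ hb1 hb2
  rintro a - b - hab ⟨hA, hB⟩
  -- a non-root inside
  obtain ⟨t, ht, htp⟩ : ∃ t ∈ Set.Ioo a b, p.eval t ≠ 0 := by
    by_contra! hcon
    exact hp (Polynomial.eq_zero_of_infinite_isRoot p
      ((Set.Ioo_infinite hab).mono fun t ht => hcon t ht))
  have hcont : ContinuousAt (fun t => |p.eval t|) t := (p.continuous.abs).continuousAt
  have hpos : 0 < |p.eval t| := abs_pos.2 htp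
  have hev : ∀ᶠ y in nhds t, |p.eval t| / 2 < |p.eval y| :=
    hcont.eventually (lt_mem_nhds (by linarith))
  obtain ⟨e, he, hball⟩ := Metric.eventually_nhds_iff.1 hev
  have hk : ∀ᶠ k in atTop, |p.eval (x k)| < |p.eval t| / 2 ∧ |x (k+1) - x k| < e := by
    have h0' := h0.abs
    have h1' := h1.abs
    rw [abs_zero] at h0' h1'
    exact (h0'.eventually (gt_mem_nhds (by linarith))).and (h1'.eventually (gt_mem_nhds he))
  obtain ⟨N, hN⟩ := eventually_atTop.1 hk
  have hfar : ∀ k ≥ N, e ≤ |x k - t| := by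
    intro k hk
    by_contra! h
    have := @hball (x k) (by rwa [Real.dist_eq])
    linarith [(hN k hk).1]
  have hstay : ∀ k ≥ N, x k < t → x (k+1) < t := by
    intro k hk h
    have h1 := hfar k hk
    rw [abs_of_neg (by linarith)] at h1
    have := (abs_lt.1 (hN k hk).2).2
    linarith
  obtain ⟨k, hk, hka⟩ := frequently_atTop.1 hA N
  have hall : ∀ m ≥ k, x m < t := by
    intro m hm
    induction m, hm using Nat.le_induction with
    | base => linarith [ht.1]
    | succ m hm ih => exact hstay m (by omega) ih
  obtain ⟨m, hm, hmb⟩ := frequently_atTop.1 hB k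
  linarith [hall m hm, ht.2]

lemma avg_conv (u : ℕ) (x : ℕ → Fin u → ℝ) (P : ℕ → Fin u → Fin u → ℝ)
    (hx : ∀ k i, 0 ≤ x k i) (hP : ∀ k i l, 0 ≤ P k i l) (hsym : ∀ k i l, P k i l = P k l i)
    (hsum : ∀ k i, ∑ l, P k i l = 1) (hdiag : ∀ k i, 1 ≤ u * P k i i)
    (hstep : ∀ k i, x (k+1) i = ∑ l, P k i l * x k l) :
    ∀ i, ∃ l, Tendsto (fun k => x k i) atTop (nhds l) := by
  have hcol : ∀ k (f : Fin u → ℝ), ∑ i, ∑ l, P k i l * f l = ∑ l, f l := by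
    intro k f
    rw [Finset.sum_comm]
    refine Finset.sum_congr rfl fun l _ => ?_
    rw [← Finset.sum_mul]
    have : ∑ i, P k i l = 1 := by
      rw [← hsum k l]; exact Finset.sum_congr rfl fun i _ => hsym k i l
    rw [this, one_mul]
  have hpow : ∀ p : ℕ, ∃ ℓ, Tendsto (fun k => ∑ i, x k i ^ p) atTop (nhds ℓ) := by
    intro p
    have hanti : Antitone (fun k => ∑ i, x k i ^ p) := by
      refine antitone_nat_of_succ_le fun k => ?_
      rw [← hcol k (fun l => x k l ^ p)]
      refine Finset.sum_le_sum fun i _ => ?_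
      rw [hstep]
      exact Real.pow_arith_mean_le_arith_mean_pow _ _ _ (fun l _ => hP k i l) (hsum k i)
        (fun l _ => hx k l) p
    refine ⟨_, tendsto_atTop_ciInf hanti ⟨0, ?_⟩⟩
    rintro _ ⟨k, rfl⟩
    exact Finset.sum_nonneg fun i _ => pow_nonneg (hx k i) p
  have hpoly : ∀ q : Polynomial ℝ, ∃ ℓ, Tendsto (fun k => ∑ i, q.eval (x k i)) atTop (nhds ℓ) := by
    intro q
    induction q using Polynomial.induction_on' with
    | add p q hp hq =>
      obtain ⟨a, ha⟩ := hp
      obtain ⟨b, hb⟩ := hq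
      refine ⟨a + b, ?_⟩
      simpa [Finset.sum_add_distrib] using ha.add hb
    | monomial n a =>
      obtain ⟨l, hl⟩ := hpow n
      refine ⟨a * l, ?_⟩
      simpa [Finset.mul_sum] using hl.const_mul a
  have hS : ∀ k i, x k i ≤ ∑ i, x 0 i := by
    intro k i
    have h1 : ∑ i, x k i = ∑ i, x 0 i := by
      induction k with
      | zero => rfl
      | succ k ih => rw [← ih, ← hcol k (x k)]; exact Finset.sum_congr rfl fun i _ => hstep k i
    rw [← h1]
    exact Finset.single_le_sum (fun i _ => hx k i) (Finset.mem_univ i)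
  set S := ∑ i, x 0 i
  have hinc : ∀ i, Tendsto (fun k => x (k+1) i - x k i) atTop (nhds 0) := by
    intro i
    obtain ⟨l, hl⟩ := hpow 2
    have hl' := (tendsto_add_atTop_iff_nat 1).2 hl
    have hd : Tendsto (fun k => u * ((∑ i, x k i ^ 2) - ∑ i, x (k+1) i ^ 2)) atTop (nhds 0) := by
      simpa using (hl.sub hl').const_mul (u : ℝ)
    have hsq : Tendsto (fun k => (x (k+1) i - x k i) ^ 2) atTop (nhds 0) := by
      refine squeeze_zero (fun k => sq_nonneg _) (fun k => ?_) hd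
      have hrow : ∀ i, ∑ l, P k i l * x k l ^ 2 - x (k+1) i ^ 2
          = ∑ l, P k i l * (x k l - x (k+1) i) ^ 2 := by
        intro i
        have : ∀ l, P k i l * (x k l - x (k+1) i) ^ 2 = P k i l * x k l ^ 2
          - 2 * x (k+1) i * (P k i l * x k l) + x (k+1) i ^ 2 * P k i l := fun l => by ring
        simp_rw [this]
        rw [Finset.sum_add_distrib, Finset.sum_sub_distrib, ← Finset.mul_sum, ← Finset.mul_sum,
          hsum, ← hstep]
        ring
      have h2 : P k i i * (x k i - x (k+1) i) ^ 2 ≤ (∑ i, x k i ^ 2) - ∑ i, x (k+1) i ^ 2 := by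
        rw [← hcol k (fun l => x k l ^ 2), ← Finset.sum_sub_distrib]
        simp_rw [hrow]
        refine le_trans ?_ (Finset.single_le_sum (f := fun i => ∑ l, P k i l * (x k l - x (k+1) i) ^ 2)
          (fun i _ => Finset.sum_nonneg fun l _ => mul_nonneg (hP k i l) (sq_nonneg _))
          (Finset.mem_univ i))
        exact Finset.single_le_sum (f := fun l => P k i l * (x k l - x (k+1) i) ^ 2)
          (fun l _ => mul_nonneg (hP k i l) (sq_nonneg _)) (Finset.mem_univ i)
      have h3 := mul_le_mul_of_nonneg_left h2 (Nat.cast_nonneg (α := ℝ) u)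
      have h4 := mul_le_mul_of_nonneg_right (hdiag k i) (sq_nonneg (x k i - x (k+1) i))
      nlinarith
    have := hsq.sqrt
    simp only [Real.sqrt_sq_eq_abs, Real.sqrt_zero] at this
    exact (tendsto_zero_iff_abs_tendsto_zero _).2 this
  -- cluster point
  have hcomp : IsCompact (Set.univ.pi fun _ : Fin u => Set.Icc (0:ℝ) S) :=
    isCompact_univ_pi fun _ => isCompact_Icc
  obtain ⟨s, -, φ, hφ, hlim⟩ := hcomp.tendsto_subseq (x := x)
    (fun k i _ => ⟨hx k i, hS k i⟩)
  rw [tendsto_pi_nhds] at hlim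
  set q : Polynomial ℝ := ∏ l, (Polynomial.X - Polynomial.C (s l)) with hq
  have hq0 : q ≠ 0 := Finset.prod_ne_zero_iff.2 fun l _ => Polynomial.X_sub_C_ne_zero _
  have hqs : ∀ i, q.eval (s i) = 0 := by
    intro i
    rw [hq, Polynomial.eval_prod]
    exact Finset.prod_eq_zero (Finset.mem_univ i) (by simp)
  obtain ⟨ℓ, hℓ⟩ := hpoly (q ^ 2)
  have hℓ' : Tendsto (fun k => ∑ i, (q^2).eval (x (φ k) i)) atTop (nhds (∑ i, (q^2).eval (s i))) :=
    tendsto_finsetSum _ fun i _ => ((q^2).continuous.tendsto _).comp (hlim i)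
  have hz : ℓ = 0 := by
    rw [tendsto_nhds_unique (hℓ.comp hφ.tendsto_atTop) hℓ']
    simp [hqs]
  subst hz
  intro i
  refine scalar_conv _ S (fun k => abs_le.2 ⟨by linarith [hx k i, hS k i], hS k i⟩) q hq0 ?_ (hinc i)
  have : Tendsto (fun k => (q.eval (x k i))^2) atTop (nhds 0) := by
    refine squeeze_zero (fun k => sq_nonneg _) (fun k => ?_) hℓ
    simp only [Polynomial.eval_pow]
    exact Finset.single_le_sum (f := fun i => q.eval (x k i) ^ 2) (fun i _ => sq_nonneg _)
      (Finset.mem_univ i)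
  have := this.sqrt
  simp only [Real.sqrt_sq_eq_abs, Real.sqrt_zero] at this
  exact (tendsto_zero_iff_abs_tendsto_zero _).2 this

lemma adm_row_pos {u v : ℕ} {A : Matrix (Fin u) (Fin v) ℝ} (h : Admissible A) (i : Fin u) :
    0 < ∑ j, A i j := by
  obtain ⟨j, hj⟩ := h.2.1 i
  exact Finset.sum_pos' (fun j _ => h.1 i j) ⟨j, Finset.mem_univ j, lt_of_le_of_ne (h.1 i j) hj.symm⟩

lemma adm_col_pos {u v : ℕ} {A : Matrix (Fin u) (Fin v) ℝ} (h : Admissible A) (j : Fin v) :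
    0 < ∑ i, A i j := by
  obtain ⟨i, hi⟩ := h.2.2 j
  exact Finset.sum_pos' (fun i _ => h.1 i j) ⟨i, Finset.mem_univ i, lt_of_le_of_ne (h.1 i j) hi.symm⟩

lemma rowNorm_adm {u v : ℕ} {A : Matrix (Fin u) (Fin v) ℝ} (h : Admissible A) :
    Admissible (rowNorm A) := by
  refine ⟨fun i j => div_nonneg (h.1 i j) (adm_row_pos h i).le, fun i => ?_, fun j => ?_⟩
  · obtain ⟨j, hj⟩ := h.2.1 i
    exact ⟨j, div_ne_zero hj (adm_row_pos h i).ne'⟩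
  · obtain ⟨i, hi⟩ := h.2.2 j
    exact ⟨i, div_ne_zero hi (adm_row_pos h i).ne'⟩

lemma colNorm_adm {u v : ℕ} {A : Matrix (Fin u) (Fin v) ℝ} (h : Admissible A) :
    Admissible (colNorm A) := by
  refine ⟨fun i j => div_nonneg (h.1 i j) (adm_col_pos h j).le, fun i => ?_, fun j => ?_⟩
  · obtain ⟨j, hj⟩ := h.2.1 i
    exact ⟨j, div_ne_zero hj (adm_col_pos h j).ne'⟩
  · obtain ⟨i, hi⟩ := h.2.2 j
    exact ⟨i, div_ne_zero hi (adm_col_pos h j).ne'⟩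

lemma rowNorm_sum {u v : ℕ} {A : Matrix (Fin u) (Fin v) ℝ} (h : Admissible A) (i : Fin u) :
    ∑ j, rowNorm A i j = 1 := by
  simp only [rowNorm, Matrix.of_apply]
  rw [← Finset.sum_div, div_self (adm_row_pos h i).ne']

lemma colNorm_sum {u v : ℕ} {A : Matrix (Fin u) (Fin v) ℝ} (h : Admissible A) (j : Fin v) :
    ∑ i, colNorm A i j = 1 := by
  simp only [colNorm, Matrix.of_apply]
  rw [← Finset.sum_div, div_self (adm_col_pos h j).ne']

lemma skL_adm {u v : ℕ} {M : Matrix (Fin u) (Fin v) ℝ} (h : Admissible M) (k : ℕ) :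
    Admissible (skL M k) := by
  induction k with
  | zero => exact rowNorm_adm h
  | succ k ih => exact rowNorm_adm (colNorm_adm ih)

lemma skT_adm {u v : ℕ} {M : Matrix (Fin u) (Fin v) ℝ} (h : Admissible M) (k : ℕ) :
    Admissible (skT M k) := colNorm_adm (skL_adm h k)

lemma skL_sum {u v : ℕ} {M : Matrix (Fin u) (Fin v) ℝ} (h : Admissible M) (k : ℕ) (i : Fin u) :
    ∑ j, skL M k i j = 1 := by
  cases k with
  | zero => exact rowNorm_sum h i
  | succ k => exact rowNorm_sum (skT_adm h k) i

lemma skT_sum {u v : ℕ} {M : Matrix (Fin u) (Fin v) ℝ} (h : Admissible M) (k : ℕ) (j : Fin v) :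
    ∑ i, skT M k i j = 1 := colNorm_sum (skL_adm h k) j

lemma skL_total {u v : ℕ} {M : Matrix (Fin u) (Fin v) ℝ} (h : Admissible M) (k : ℕ) :
    ∑ j, ∑ i, skL M k i j = u := by
  rw [Finset.sum_comm]
  simp [skL_sum h k]

lemma skT_eq {u v : ℕ} (M : Matrix (Fin u) (Fin v) ℝ) (k : ℕ) (i : Fin u) (j : Fin v) :
    skT M k i j = skL M k i j / ∑ l, skL M k l j := rfl

lemma skL_succ {u v : ℕ} (M : Matrix (Fin u) (Fin v) ℝ) (k : ℕ) (i : Fin u) (j : Fin v) :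
    skL M (k+1) i j = skT M k i j / ∑ l, skT M k i l := rfl

lemma row_conv {u v : ℕ} {M : Matrix (Fin u) (Fin v) ℝ} (h : Admissible M) :
    ∀ i, ∃ l, Tendsto (fun k => ∑ j, skT M k i j) atTop (nhds l) := by
  refine avg_conv u (fun k i => ∑ j, skT M k i j)
    (fun k i l => ∑ j, skL M (k+1) i j * skL M (k+1) l j / ∑ m, skL M (k+1) m j)
    (fun k i => (adm_row_pos (skT_adm h k) i).le) ?_ ?_ ?_ ?_ ?_
  · intro k i l
    exact Finset.sum_nonneg fun j _ => div_nonneg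
      (mul_nonneg ((skL_adm h (k+1)).1 i j) ((skL_adm h (k+1)).1 l j))
      (adm_col_pos (skL_adm h (k+1)) j).le
  · intro k i l
    exact Finset.sum_congr rfl fun j _ => by rw [mul_comm]
  · intro k i
    rw [Finset.sum_comm, ← skL_sum h (k+1) i]
    refine Finset.sum_congr rfl fun j _ => ?_
    rw [← Finset.sum_div, ← Finset.mul_sum, mul_div_assoc,
      div_self (adm_col_pos (skL_adm h (k+1)) j).ne', mul_one]
  · intro k i
    have := Finset.sq_sum_div_le_sum_sq_div Finset.univ (fun j => skL M (k+1) i j)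
      (g := fun j => ∑ m, skL M (k+1) m j) (fun j _ => adm_col_pos (skL_adm h (k+1)) j)
    rw [skL_sum h, skL_total h] at this
    have hu : (0:ℝ) < u := by exact_mod_cast i.pos
    rw [div_le_iff₀ hu] at this
    simp only [sq] at this
    linarith
  · intro k i
    simp_rw [Finset.sum_mul]
    rw [Finset.sum_comm]
    refine Finset.sum_congr rfl fun j _ => ?_
    have hc := (adm_col_pos (skL_adm h (k+1)) j).ne'
    have : ∀ l, skL M (k+1) i j * skL M (k+1) l j / (∑ m, skL M (k+1) m j) * ∑ j, skT M k l j
       = skL M (k+1) i j / (∑ m, skL M (k+1) m j) * skT M k l j := by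
      intro l
      have := (adm_row_pos (skT_adm h k) l).ne'
      rw [skL_succ M k l j]
      field_simp
    simp_rw [this]
    rw [← Finset.mul_sum, skT_sum h, mul_one, skT_eq]

lemma sk_transpose {u v : ℕ} (M : Matrix (Fin u) (Fin v) ℝ) (k : ℕ) :
    skL (rowNorm M)ᵀ k = (skT M k)ᵀ ∧ skT (rowNorm M)ᵀ k = (skL M (k+1))ᵀ := by
  induction k with
  | zero => exact ⟨rfl, rfl⟩
  | succ k ih =>
    have h1 : skL (rowNorm M)ᵀ (k+1) = (skT M (k+1))ᵀ := by
      change rowNorm (skT (rowNorm M)ᵀ k) = _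
      rw [ih.2]; rfl
    refine ⟨h1, ?_⟩
    change colNorm (skL (rowNorm M)ᵀ (k+1)) = _
    rw [h1]; rfl

lemma col_conv {u v : ℕ} {M : Matrix (Fin u) (Fin v) ℝ} (h : Admissible M) :
    ∀ j, ∃ l, Tendsto (fun k => ∑ i, skL M k i j) atTop (nhds l) := by
  intro j
  have h' : Admissible (rowNorm M)ᵀ :=
    ⟨fun i j => (rowNorm_adm h).1 j i, (rowNorm_adm h).2.2, (rowNorm_adm h).2.1⟩
  obtain ⟨l, hl⟩ := row_conv h' j
  refine ⟨l, ?_⟩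
  rw [← tendsto_add_atTop_iff_nat 1]
  simpa [(sk_transpose M _).2] using hl

lemma row_lower {u v : ℕ} {M : Matrix (Fin u) (Fin v) ℝ} (h : Admissible M) (k : ℕ) (i : Fin u) :
    1 / (u:ℝ) ≤ ∑ j, skT M k i j := by
  rw [← skL_sum h k i, Finset.sum_div]
  refine Finset.sum_le_sum fun j _ => ?_
  rw [skT_eq]
  refine div_le_div_of_nonneg_left ((skL_adm h k).1 i j) (adm_col_pos (skL_adm h k) j) ?_
  rw [← skL_total h k]
  exact Finset.single_le_sum (f := fun j => ∑ i, skL M k i j)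
    (fun j _ => (adm_col_pos (skL_adm h k) j).le) (Finset.mem_univ j)

lemma col_lower {u v : ℕ} {M : Matrix (Fin u) (Fin v) ℝ} (h : Admissible M) (k : ℕ) (j : Fin v) :
    1 / (v:ℝ) ≤ ∑ i, skL M (k+1) i j := by
  rw [← skT_sum h k j, Finset.sum_div]
  refine Finset.sum_le_sum fun i _ => ?_
  rw [skL_succ]
  refine div_le_div_of_nonneg_left ((skT_adm h k).1 i j) (adm_row_pos (skT_adm h k) i) ?_
  have : ∑ i, ∑ j, skT M k i j = (v:ℝ) := by
    have hcm := Finset.sum_comm (s := (Finset.univ : Finset (Fin u)))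
      (t := (Finset.univ : Finset (Fin v))) (f := fun i j => skT M k i j)
    refine hcm.trans ?_
    simp [skT_sum h k]
  rw [← this]
  exact Finset.single_le_sum (f := fun i => ∑ j, skT M k i j)
    (fun i _ => (adm_row_pos (skT_adm h k) i).le) (Finset.mem_univ i)

/-- ratio bound: growth contradiction -/
lemma ratio_ge_one (x a : ℕ → ℝ) (l : ℝ) (hx : ∀ k, 0 < x k) (hx1 : ∀ k, x k ≤ 1)
    (ha : Tendsto a atTop (nhds l)) (hpos : ∀ k, 0 < a k)
    (hstep : ∀ k, x (k+1) = x k / a k) : 1 ≤ l := by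
  by_contra! hl
  obtain ⟨q, hq1, hq2⟩ := exists_between hl
  have hl0 : 0 ≤ l := ge_of_tendsto' ha fun k => (hpos k).le
  have hq0 : 0 ≤ q := by linarith
  obtain ⟨N, hN⟩ := eventually_atTop.1 (ha.eventually (gt_mem_nhds hq1))
  have hb : ∀ n, x N ≤ q ^ n := by
    intro n
    have : x N ≤ q ^ n * x (N + n) := by
      induction n with
      | zero => simp
      | succ n ih =>
        have h1 : x (N+n) = a (N+n) * x (N+(n+1)) := by
          rw [← add_assoc, hstep]; field_simp [(hpos (N+n)).ne']
        have h2 : x (N+n) ≤ q * x (N+(n+1)) := by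
          rw [h1]; exact mul_le_mul_of_nonneg_right (hN _ (by omega)).le (hx _).le
        calc x N ≤ q ^ n * x (N+n) := ih
          _ ≤ q ^ n * (q * x (N+(n+1))) := by gcongr
          _ = _ := by ring
    refine this.trans ?_
    exact mul_le_of_le_one_right (by positivity) (hx1 _)
  have := ge_of_tendsto' (tendsto_pow_atTop_nhds_zero_of_lt_one (by linarith) hq2) hb
  linarith [hx N]

lemma ratio_gt_one (x a : ℕ → ℝ) (l : ℝ) (hx : ∀ k, 0 ≤ x k)
    (ha : Tendsto a atTop (nhds l)) (hl : 1 < l)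
    (hstep : ∀ k, x (k+1) = x k / a k) : Tendsto x atTop (nhds 0) := by
  obtain ⟨q, hq1, hq2⟩ := exists_between hl
  obtain ⟨N, hN⟩ := eventually_atTop.1 (ha.eventually (lt_mem_nhds hq2))
  rw [← tendsto_add_atTop_iff_nat N]
  have hb : ∀ n, x (n + N) ≤ x N * (q⁻¹) ^ n := by
    intro n
    induction n with
    | zero => simp
    | succ n ih =>
      rw [show n + 1 + N = (n + N) + 1 by ring, hstep, pow_succ, ← mul_assoc, ← div_eq_mul_inv]
      exact div_le_div₀ (by have := hx N; positivity) ih (by linarith) (hN _ (by omega)).le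
  refine squeeze_zero (fun n => hx _) hb ?_
  simpa using (tendsto_pow_atTop_nhds_zero_of_lt_one (r := q⁻¹) (by positivity)
    (inv_lt_one_of_one_lt₀ hq1)).const_mul (x N)

lemma hellinger (a b : ℝ) (ha : 0 ≤ a) (hb : 0 ≤ b) (hab : a ≠ 0 → b ≠ 0) :
    (√b - √a) ^ 2 ≤ a * Real.log a - a * Real.log b - a + b := by
  rcases eq_or_lt_of_le ha with rfl | ha'
  · simp [Real.sq_sqrt hb]
  · have hb' : 0 < b := lt_of_le_of_ne hb (hab ha'.ne').symm
    have hsa := Real.sqrt_pos.2 ha'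
    have hsb := Real.sqrt_pos.2 hb'
    have h1 := Real.log_le_sub_one_of_pos (div_pos hsb hsa)
    rw [Real.log_div hsb.ne' hsa.ne', Real.log_sqrt hb, Real.log_sqrt ha] at h1
    have h2 := mul_le_mul_of_nonneg_left h1 ha
    have h3 : a * (√b / √a - 1) = √a * √b - a := by
      have := Real.sq_sqrt ha
      field_simp
      nlinarith
    have h4 := Real.sq_sqrt ha
    have h5 := Real.sq_sqrt hb
    nlinarith

/-- Every admissible u×v matrix converges under Sinkhorn iteration to a
stable pair of matrices. -/
theorem sinkhorn_converges (u v : ℕ) (M : Matrix (Fin u) (Fin v) ℝ)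
    (hM : Admissible M) :
    ∃ L T : Matrix (Fin u) (Fin v) ℝ,
      Stable L T ∧ EntrywiseLimit (skL M) L ∧ EntrywiseLimit (skT M) T := by
  choose r hr using row_conv hM
  choose c hc using col_conv hM
  have hrpos : ∀ i, 0 < r i := by
    intro i
    have hu : (0:ℝ) < u := by exact_mod_cast i.pos
    exact lt_of_lt_of_le (one_div_pos.2 hu) (ge_of_tendsto' (hr i) fun k => row_lower hM k i)
  have hcpos : ∀ j, 0 < c j := by
    intro j
    have hv : (0:ℝ) < v := by exact_mod_cast j.pos
    exact lt_of_lt_of_le (one_div_pos.2 hv)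
      (ge_of_tendsto' ((tendsto_add_atTop_iff_nat 1).2 (hc j)) fun k => col_lower hM k j)
  have hrk : ∀ k i, 0 < ∑ j, skT M k i j := fun k i => adm_row_pos (skT_adm hM k) i
  have hck : ∀ k j, 0 < ∑ i, skL M k i j := fun k j => adm_col_pos (skL_adm hM k) j
  have hL0 : ∀ k i j, 0 ≤ skL M k i j := fun k => (skL_adm hM k).1
  have hL1 : ∀ k i j, skL M k i j ≤ 1 := by
    intro k i j
    rw [← skL_sum hM k i]
    exact Finset.single_le_sum (fun j _ => hL0 k i j) (Finset.mem_univ j)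
  have hstep : ∀ k i j, skL M (k+1) i j =
      skL M k i j / ((∑ j, skT M k i j) * (∑ i, skL M k i j)) := by
    intro k i j
    rw [skL_succ, skT_eq, div_div, mul_comm]
  have hlim : ∀ i j, Tendsto (fun k => (∑ j, skT M k i j) * (∑ i, skL M k i j)) atTop
      (nhds (r i * c j)) := fun i j => (hr i).mul (hc j)
  have hsupp : ∀ k i j, skL M k i j = 0 ↔ M i j = 0 := by
    intro k i j
    induction k with
    | zero =>
      change M i j / _ = 0 ↔ _
      rw [div_eq_zero_iff]
      simp [(adm_row_pos hM i).ne']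
    | succ k ih =>
      rw [hstep, div_eq_zero_iff, ← ih]
      simp [(mul_pos (hrk k i) (hck k j)).ne']
  have hge : ∀ i j, M i j ≠ 0 → 1 ≤ r i * c j := by
    intro i j hij
    exact ratio_ge_one (fun k => skL M k i j) _ _
      (fun k => lt_of_le_of_ne (hL0 k i j) (fun h => hij ((hsupp k i j).1 h.symm)))
      (fun k => hL1 k i j) (hlim i j) (fun k => mul_pos (hrk k i) (hck k j)) (fun k => hstep k i j)
  -- accumulation point
  have hcomp : IsCompact (Set.univ.pi fun _ : Fin u => Set.univ.pi fun _ : Fin v =>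
      Set.Icc (0:ℝ) 1) := isCompact_univ_pi fun _ => isCompact_univ_pi fun _ => isCompact_Icc
  obtain ⟨L, -, φ, hφ, hLlim⟩ := hcomp.tendsto_subseq
    (x := fun (k : ℕ) (i : Fin u) (j : Fin v) => skL M k i j)
    (fun k i _ j _ => ⟨hL0 k i j, hL1 k i j⟩)
  have hLlim' : ∀ i j, Tendsto (fun k => skL M (φ k) i j) atTop (nhds (L i j)) := by
    intro i j
    exact tendsto_pi_nhds.1 (tendsto_pi_nhds.1 hLlim i) j
  have hLnn : ∀ i j, 0 ≤ L i j := fun i j => ge_of_tendsto' (hLlim' i j) fun k => hL0 _ i j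
  have hLM : ∀ i j, M i j = 0 → L i j = 0 := by
    intro i j hij
    have : (fun k => skL M (φ k) i j) = fun _ => 0 := funext fun k => (hsupp _ i j).2 hij
    have h2 := hLlim' i j
    rw [this] at h2
    exact (tendsto_nhds_unique h2 tendsto_const_nhds)
  have hLrc : ∀ i j, L i j ≠ 0 → r i * c j = 1 := by
    intro i j hij
    refine le_antisymm ?_ (hge i j fun h => hij (hLM i j h))
    by_contra! hgt
    have := ratio_gt_one (fun k => skL M k i j) _ _ (fun k => hL0 k i j) (hlim i j) hgt
      (fun k => hstep k i j)
    exact hij (tendsto_nhds_unique (hLlim' i j) (this.comp hφ.tendsto_atTop))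
  have hLrow : ∀ i, ∑ j, L i j = 1 := by
    intro i
    have h1 : Tendsto (fun k => ∑ j, skL M (φ k) i j) atTop (nhds (∑ j, L i j)) :=
      tendsto_finsetSum _ fun j _ => hLlim' i j
    simp only [skL_sum hM] at h1
    exact tendsto_nhds_unique h1 tendsto_const_nhds
  have hLcol : ∀ j, ∑ i, L i j = c j := by
    intro j
    have h1 : Tendsto (fun k => ∑ i, skL M (φ k) i j) atTop (nhds (∑ i, L i j)) :=
      tendsto_finsetSum _ fun i _ => hLlim' i j
    exact tendsto_nhds_unique h1 ((hc j).comp hφ.tendsto_atTop)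
  have hctot : ∑ j, c j = u := by
    simp_rw [← hLcol]; rw [Finset.sum_comm]; simp [hLrow]
  -- monotonicity
  have hPhi : ∀ k, ∑ i, (∑ j, skT M k i j) / r i ≤ u := by
    intro k
    have h1 : ∀ i j, skT M k i j / r i ≤ skT M k i j * c j := by
      intro i j
      by_cases hij : M i j = 0
      · rw [skT_eq, (hsupp k i j).2 hij]; simp
      · rw [div_le_iff₀ (hrpos i)]
        have := mul_le_mul_of_nonneg_left (hge i j hij) ((skT_adm hM k).1 i j)
        nlinarith
    calc ∑ i, (∑ j, skT M k i j) / r i = ∑ i, ∑ j, skT M k i j / r i := by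
          simp_rw [Finset.sum_div]
      _ ≤ ∑ i, ∑ j, skT M k i j * c j :=
          Finset.sum_le_sum fun i _ => Finset.sum_le_sum fun j _ => h1 i j
      _ = ∑ j, c j := by
          rw [Finset.sum_comm]
          simp_rw [← Finset.sum_mul, skT_sum hM, one_mul]
      _ = u := hctot
  have hmono : Monotone (fun k => ∑ i, ∑ j, L i j * Real.log (skL M k i j)) := by
    refine monotone_nat_of_le_succ fun k => ?_
    have hterm : ∀ i j, L i j * Real.log (skL M k i j) - L i j * Real.log (skL M (k+1) i j)
        ≤ L i j * ((∑ j, skT M k i j) / r i) + L i j / c j * (∑ i, skL M k i j) - 2 * L i j := by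
      intro i j
      by_cases hij : L i j = 0
      · simp [hij]
      · have hne : skL M k i j ≠ 0 := fun h => hij (hLM i j ((hsupp k i j).1 h))
        have hrc := hLrc i j hij
        rw [hstep, Real.log_div hne (mul_pos (hrk k i) (hck k j)).ne',
          Real.log_mul (hrk k i).ne' (hck k j).ne']
        have e1 := Real.log_le_sub_one_of_pos (div_pos (hrk k i) (hrpos i))
        have e2 := Real.log_le_sub_one_of_pos (div_pos (hck k j) (hcpos j))
        rw [Real.log_div (hrk k i).ne' (hrpos i).ne'] at e1
        rw [Real.log_div (hck k j).ne' (hcpos j).ne'] at e2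
        have e3 : Real.log (r i) + Real.log (c j) = 0 := by
          rw [← Real.log_mul (hrpos i).ne' (hcpos j).ne', hrc, Real.log_one]
        have e4 := mul_le_mul_of_nonneg_left (add_le_add e1 e2) (hLnn i j)
        have e5 : L i j / c j * (∑ i, skL M k i j) = L i j * ((∑ i, skL M k i j) / c j) := by ring
        rw [e5]
        have e6 : L i j * (Real.log (r i) + Real.log (c j)) = 0 := by rw [e3, mul_zero]
        nlinarith
    have hs := Finset.sum_le_sum fun i (_ : i ∈ Finset.univ) =>
      Finset.sum_le_sum fun j (_ : j ∈ Finset.univ) => hterm i j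
    simp only [Finset.sum_sub_distrib, Finset.sum_add_distrib, ← Finset.mul_sum] at hs
    have t1 : ∑ i, ∑ j, L i j * ((∑ j, skT M k i j) / r i) ≤ u := by
      simp_rw [← Finset.sum_mul, hLrow, one_mul]; exact hPhi k
    have t2 : ∑ i, ∑ j, L i j / c j * (∑ i, skL M k i j) = u := by
      rw [Finset.sum_comm, ← skL_total hM k]
      refine Finset.sum_congr rfl fun j _ => ?_
      rw [← Finset.sum_mul, ← Finset.sum_div, hLcol, div_self (hcpos j).ne', one_mul]
    have t3 : ∑ i, ∑ j, L i j = (u:ℝ) := by simp [hLrow]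
    simp only [hLrow, Finset.sum_const, Finset.card_univ, Fintype.card_fin, nsmul_eq_mul, mul_one,
      ← Finset.sum_mul, one_mul] at hs t1 t2
    have := hPhi k
    linarith
  have hFsub : Tendsto (fun k => ∑ i, ∑ j, L i j * Real.log (skL M (φ k) i j)) atTop
      (nhds (∑ i, ∑ j, L i j * Real.log (L i j))) := by
    refine tendsto_finsetSum _ fun i _ => tendsto_finsetSum _ fun j _ => ?_
    by_cases hij : L i j = 0
    · simp [hij]
    · exact ((hLlim' i j).log hij).const_mul _
  have hF : Tendsto (fun k => ∑ i, ∑ j, L i j * Real.log (skL M k i j)) atTop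
      (nhds (∑ i, ∑ j, L i j * Real.log (L i j))) :=
    (tendsto_iff_tendsto_subseq_of_monotone hmono hφ.tendsto_atTop).2 hFsub
  have hD : Tendsto (fun k => (∑ i, ∑ j, L i j * Real.log (L i j))
      - ∑ i, ∑ j, L i j * Real.log (skL M k i j)) atTop (nhds 0) := by
    simpa using hF.const_sub (∑ i, ∑ j, L i j * Real.log (L i j))
  have hconv : EntrywiseLimit (skL M) L := by
    intro i j
    have hnn : ∀ k i j, (√(skL M k i j) - √(L i j)) ^ 2 ≤ L i j * Real.log (L i j)
        - L i j * Real.log (skL M k i j) - L i j + skL M k i j := fun k i j =>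
      hellinger _ _ (hLnn i j) (hL0 k i j) fun h h' => h (hLM i j ((hsupp k i j).1 h'))
    have hsq : Tendsto (fun k => (√(skL M k i j) - √(L i j)) ^ 2) atTop (nhds 0) := by
      refine squeeze_zero (fun k => sq_nonneg _) (fun k => ?_) hD
      have hs : ∑ i, ∑ j, (√(skL M k i j) - √(L i j)) ^ 2 ≤ _ :=
        Finset.sum_le_sum fun i (_ : i ∈ Finset.univ) =>
        Finset.sum_le_sum fun j (_ : j ∈ Finset.univ) => hnn k i j
      simp only [Finset.sum_sub_distrib, Finset.sum_add_distrib, hLrow, skL_sum hM] at hs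
      have h1 := Finset.single_le_sum (f := fun j => (√(skL M k i j) - √(L i j)) ^ 2)
        (fun j _ => sq_nonneg _) (Finset.mem_univ j)
      have h2 := Finset.single_le_sum (f := fun i => ∑ j, (√(skL M k i j) - √(L i j)) ^ 2)
        (fun i _ => Finset.sum_nonneg fun j _ => sq_nonneg _) (Finset.mem_univ i)
      beta_reduce at h1 h2
      linarith
    have h1 := hsq.sqrt
    simp only [Real.sqrt_sq_eq_abs, Real.sqrt_zero] at h1
    have h2 := (tendsto_zero_iff_abs_tendsto_zero _).2 h1
    have h3 : Tendsto (fun k => √(skL M k i j)) atTop (nhds (√(L i j))) :=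
      tendsto_sub_nhds_zero_iff.1 h2
    have h4 := h3.pow 2
    simpa only [Real.sq_sqrt (hL0 _ i j), Real.sq_sqrt (hLnn i j)] using h4
  have hTlim : ∀ i j, Tendsto (fun k => skT M k i j) atTop (nhds (L i j / c j)) := by
    intro i j
    simp only [skT_eq]
    exact (hconv i j).div (hc j) (hcpos j).ne'
  have hTrow : ∀ i, ∑ j, L i j / c j = r i := fun i =>
    tendsto_nhds_unique (tendsto_finsetSum _ fun j _ => hTlim i j) (hr i)
  refine ⟨L, Matrix.of fun i j => L i j / c j, ⟨?_, ?_⟩, hconv, fun i j => hTlim i j⟩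
  · ext i j
    simp only [colNorm, Matrix.of_apply, hLcol]
  · ext i j
    simp only [rowNorm, Matrix.of_apply, hTrow]
    by_cases hij : L i j = 0
    · simp [hij]
    · rw [div_div, mul_comm, hLrc i j hij, div_one]
end

section
/- An admissible u×v matrix M converges under Sinkhorn iteration to a stable pair of matrices if and only if there exists a stable pair of matrices (P,Q) such that P has a partial pattern of M (P ≺ M). -/
open Matrix Filter

/-- Termwise lower bound for relative entropy. -/
lemma sk_kl_term (q t : ℝ) (hq : 0 ≤ q) (ht : 0 ≤ t) (h : q ≠ 0 → t ≠ 0) :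
    (Real.sqrt q - Real.sqrt t) ^ 2 ≤ q * Real.log (q / t) - q + t := by
  rcases eq_or_lt_of_le hq with h0 | hq0
  · subst h0
    simp [Real.sq_sqrt ht]
  · have ht0 : 0 < t := lt_of_le_of_ne ht (Ne.symm (h hq0.ne'))
    have hsq : 0 < Real.sqrt q := Real.sqrt_pos.2 hq0
    have hst : 0 < Real.sqrt t := Real.sqrt_pos.2 ht0
    have e1 := Real.sq_sqrt hq
    have e2 := Real.sq_sqrt ht
    have hlog : Real.log (q / t) = - (2 * Real.log (Real.sqrt t / Real.sqrt q)) := by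
      rw [Real.log_div hst.ne' hsq.ne', Real.log_div hq0.ne' ht0.ne', Real.log_sqrt hq,
        Real.log_sqrt ht]
      ring
    have hle := Real.log_le_sub_one_of_pos (div_pos hst hsq)
    have : q * Real.log (Real.sqrt t / Real.sqrt q) ≤ Real.sqrt q * Real.sqrt t - q := by
      calc q * Real.log (Real.sqrt t / Real.sqrt q)
          ≤ q * (Real.sqrt t / Real.sqrt q - 1) := mul_le_mul_of_nonneg_left hle hq
        _ = Real.sqrt q * Real.sqrt t - q := by
          have : q * (Real.sqrt t / Real.sqrt q) = Real.sqrt q * Real.sqrt t := by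
            rw [mul_div_assoc', div_eq_iff hsq.ne']
            nlinarith
          linarith
    rw [hlog]
    nlinarith

lemma sk_core {u v : ℕ} (L T : ℕ → Fin u → Fin v → ℝ) (c : ℕ → Fin v → ℝ)
    (r : ℕ → Fin u → ℝ) (m : ℝ) (hm : 0 < m)
    (hc : ∀ k j, c k j = ∑ i, L k i j) (hr : ∀ k i, r k i = ∑ j, T k i j)
    (hL0 : ∀ k i j, 0 ≤ L k i j) (hrow : ∀ k i, ∑ j, L k i j = 1)
    (hcm : ∀ k j, m ≤ c k j) (hrm : ∀ k i, 0 < r k i)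
    (hT : ∀ k i j, T k i j = L k i j / c k j)
    (hL : ∀ k i j, L (k + 1) i j = T k i j / r k i) :
    ∃ P Q : Fin u → Fin v → ℝ, ∃ φ : ℕ → ℕ, StrictMono φ ∧
      (∀ i j, Tendsto (fun n => L (φ n) i j) atTop (nhds (P i j))) ∧
      (∀ i j, Q i j = P i j / ∑ i, P i j) ∧ (∀ j, m ≤ ∑ i, P i j) ∧
      (∀ i j, Tendsto (fun n => T n i j) atTop (nhds (Q i j))) := by
  have hcpos : ∀ k j, 0 < c k j := fun k j => hm.trans_le (hcm k j)
  have hT0 : ∀ k i j, 0 ≤ T k i j := fun k i j => by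
    rw [hT]; exact div_nonneg (hL0 _ _ _) (hcpos _ _).le
  have hcol : ∀ k j, ∑ i, T k i j = 1 := fun k j => by
    simp_rw [hT, ← Finset.sum_div, ← hc]
    exact div_self (hcpos _ _).ne'
  have hL1 : ∀ k i j, L k i j ≤ 1 := fun k i j => by
    rw [← hrow k i]
    exact Finset.single_le_sum (f := fun j => L k i j) (fun j _ => hL0 k i j) (Finset.mem_univ j)
  obtain ⟨P, -, φ, hφ, hP⟩ := (isCompact_Icc (a := (0 : Fin u → Fin v → ℝ)) (b := 1)).tendsto_subseq
    (x := L) (fun k => ⟨fun i j => hL0 k i j, fun i j => hL1 k i j⟩)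
  have hPt : ∀ i j, Tendsto (fun n => L (φ n) i j) atTop (nhds (P i j)) := fun i j =>
    tendsto_pi_nhds.1 (tendsto_pi_nhds.1 hP i) j
  have hP0 : ∀ i j, 0 ≤ P i j := fun i j => ge_of_tendsto' (hPt i j) (fun n => hL0 _ i j)
  have hct : ∀ j, Tendsto (fun n => c (φ n) j) atTop (nhds (∑ i, P i j)) := fun j => by
    simp_rw [hc]
    exact tendsto_finsetSum _ (fun i _ => hPt i j)
  have hProw : ∀ i, ∑ j, P i j = 1 := fun i => by
    have h1 : Tendsto (fun n => ∑ j, L (φ n) i j) atTop (nhds (∑ j, P i j)) :=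
      tendsto_finsetSum _ (fun j _ => hPt i j)
    simp_rw [hrow] at h1
    exact tendsto_nhds_unique h1 tendsto_const_nhds
  set γ : Fin v → ℝ := fun j => ∑ i, P i j with hγ
  have hγm : ∀ j, m ≤ γ j := fun j => ge_of_tendsto' (hct j) (fun n => hcm _ j)
  have hγpos : ∀ j, 0 < γ j := fun j => hm.trans_le (hγm j)
  set Q : Fin u → Fin v → ℝ := fun i j => P i j / γ j with hQ
  have hQ0 : ∀ i j, 0 ≤ Q i j := fun i j => div_nonneg (hP0 i j) (hγpos j).le
  have hQcol : ∀ j, ∑ i, Q i j = 1 := fun j => by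
    simp_rw [hQ, ← Finset.sum_div]
    exact div_self (hγpos j).ne'
  have hTt : ∀ i j, Tendsto (fun n => T (φ n) i j) atTop (nhds (Q i j)) := fun i j => by
    simp_rw [hT]
    exact (hPt i j).div (hct j) (hγpos j).ne'
  have hz : ∀ k i j, L (k + 1) i j = 0 ↔ L k i j = 0 := fun k i j => by
    rw [hL, hT, div_eq_zero_iff, div_eq_zero_iff]
    simp [(hcpos k j).ne', (hrm k i).ne']
  have hz0 : ∀ k i j, L k i j = 0 ↔ L 0 i j = 0 := fun k i j => by
    induction k with
    | zero => rfl
    | succ k ih => rw [hz, ih]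
  have hPz : ∀ i j, P i j ≠ 0 → ∀ k, 0 < L k i j := fun i j hne k => by
    refine lt_of_le_of_ne (hL0 k i j) (fun h => hne ?_)
    have : ∀ n, L n i j = 0 := fun n => (hz0 n i j).2 ((hz0 k i j).1 h.symm)
    have h1 := hPt i j
    simp_rw [this] at h1
    exact (tendsto_nhds_unique h1 tendsto_const_nhds)
  have hPzT : ∀ i j, P i j ≠ 0 → ∀ k, 0 < T k i j := fun i j hne k => by
    rw [hT]; exact div_pos (hPz i j hne k) (hcpos k j)
  have hcs : ∀ k, ∑ j, c k j = u := fun k => by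
    simp_rw [hc]; rw [Finset.sum_comm]; simp [hrow]
  have hγs : ∑ j, γ j = u := by
    simp_rw [hγ]; rw [Finset.sum_comm]; simp [hProw]
  set b : ℕ → ℝ := fun k => ∑ j, c k j * Real.log (c k j) with hb
  set a : ℕ → ℝ := fun k => - ∑ i, Real.log (r k i) with ha
  have hab : ∀ k, a k ≤ b k := fun k => by
    have h1 : ∀ i, - Real.log (r k i) ≤ ∑ j, L k i j * Real.log (c k j) := fun i => by
      have h2 : ∀ j, L k i j * (- Real.log (c k j) - Real.log (r k i)) ≤
          T k i j / r k i - L k i j := fun j => by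
        have h3 := Real.log_le_sub_one_of_pos (inv_pos.2 (mul_pos (hcpos k j) (hrm k i)))
        rw [Real.log_inv, Real.log_mul (hcpos k j).ne' (hrm k i).ne'] at h3
        have h4 := mul_le_mul_of_nonneg_left h3 (hL0 k i j)
        have h5 : T k i j / r k i = L k i j * (c k j * r k i)⁻¹ := by
          rw [hT, div_div, div_eq_mul_inv]
        rw [h5]
        linarith
      have h3 := Finset.sum_le_sum (s := Finset.univ) (fun j _ => h2 j)
      rw [Finset.sum_sub_distrib, ← Finset.sum_div, ← hr, div_self (hrm k i).ne', hrow] at h3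
      simp_rw [mul_sub, mul_neg] at h3
      rw [Finset.sum_sub_distrib, ← Finset.sum_mul, hrow, Finset.sum_neg_distrib] at h3
      linarith
    calc a k = ∑ i, - Real.log (r k i) := by rw [ha, Finset.sum_neg_distrib]
      _ ≤ ∑ i, ∑ j, L k i j * Real.log (c k j) := Finset.sum_le_sum (fun i _ => h1 i)
      _ = b k := by
        rw [Finset.sum_comm]
        simp_rw [← Finset.sum_mul, ← hc]
        rfl
  have hba : ∀ k, b (k + 1) ≤ a k := fun k => by
    have h1 : ∀ j, c (k + 1) j * Real.log (c (k + 1) j) ≤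
        ∑ i, L (k + 1) i j * (- Real.log (r k i)) := fun j => by
      have h2 : ∀ i, L (k + 1) i j * (Real.log (c (k + 1) j) + Real.log (r k i)) ≤
          c (k + 1) j * T k i j - L (k + 1) i j := fun i => by
        have h3 := Real.log_le_sub_one_of_pos (mul_pos (hcpos (k + 1) j) (hrm k i))
        rw [Real.log_mul (hcpos _ j).ne' (hrm k i).ne'] at h3
        have h4 := mul_le_mul_of_nonneg_left h3 (hL0 (k + 1) i j)
        have h5 : T k i j = L (k + 1) i j * r k i := by
          rw [hL, div_mul_cancel₀ _ (hrm k i).ne']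
        rw [h5]
        linarith
      have h3 := Finset.sum_le_sum (s := Finset.univ) (fun i _ => h2 i)
      rw [Finset.sum_sub_distrib, ← Finset.mul_sum, hcol, ← hc] at h3
      simp_rw [mul_add] at h3
      rw [Finset.sum_add_distrib, ← Finset.sum_mul, ← hc] at h3
      simp_rw [mul_neg]
      rw [Finset.sum_neg_distrib]
      linarith
    calc b (k + 1) ≤ ∑ j, ∑ i, L (k + 1) i j * (- Real.log (r k i)) :=
          Finset.sum_le_sum (fun j _ => h1 j)
      _ = a k := by
        rw [Finset.sum_comm]
        simp_rw [← Finset.sum_mul, hrow, one_mul]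
        rw [ha, Finset.sum_neg_distrib]
  have hbanti : Antitone b := antitone_nat_of_succ_le (fun k => (hba k).trans (hab k))
  have hbt : Tendsto (fun n => b (φ n)) atTop (nhds (∑ j, γ j * Real.log (γ j))) :=
    tendsto_finsetSum _ (fun j _ => (hct j).mul ((hct j).log (hγpos j).ne'))
  have hβ : ∀ k, ∑ j, γ j * Real.log (γ j) ≤ b k := fun k =>
    ((hbanti.comp_monotone hφ.monotone).le_of_tendsto hbt k).trans (hbanti (hφ.id_le k))
  set F : ℕ → ℝ := fun k => ∑ i, ∑ j, P i j * Real.log (Q i j / T k i j) with hF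
  have hstep : ∀ k, F (k + 1) ≤ F k := fun k => by
    have h1 : ∀ i j, P i j * Real.log (Q i j / T (k + 1) i j) =
        P i j * Real.log (Q i j / T k i j) + P i j * Real.log (r k i)
          + P i j * Real.log (c (k + 1) j) := fun i j => by
      by_cases hp : P i j = 0
      · simp [hp]
      · have hq : Q i j ≠ 0 := div_ne_zero hp (hγpos j).ne'
        rw [Real.log_div hq (hPzT i j hp _).ne', Real.log_div hq (hPzT i j hp _).ne',
          hT (k + 1), hL, Real.log_div (div_pos (hPzT i j hp k) (hrm k i)).ne' (hcpos _ _).ne',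
          Real.log_div (hPzT i j hp k).ne' (hrm k i).ne']
        ring
    have h2 : F (k + 1) = F k - a k + ∑ j, γ j * Real.log (c (k + 1) j) := by
      have e1 : ∑ i, ∑ j, P i j * Real.log (r k i) = - a k := by
        simp_rw [← Finset.sum_mul, hProw, one_mul]
        simp [ha]
      have e2 : ∑ i, ∑ j, P i j * Real.log (c (k + 1) j)
          = ∑ j, γ j * Real.log (c (k + 1) j) := by
        rw [Finset.sum_comm]
        simp_rw [← Finset.sum_mul]
        rfl
      simp_rw [hF, h1, Finset.sum_add_distrib]
      rw [e1, e2]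
      ring
    have h3 : ∑ j, γ j * Real.log (c (k + 1) j) ≤ ∑ j, γ j * Real.log (γ j) := by
      have h4 : ∀ j, γ j * Real.log (c (k + 1) j) - γ j * Real.log (γ j) ≤
          c (k + 1) j - γ j := fun j => by
        have h5 := Real.log_le_sub_one_of_pos (div_pos (hcpos (k + 1) j) (hγpos j))
        rw [Real.log_div (hcpos _ j).ne' (hγpos j).ne'] at h5
        have h6 := mul_le_mul_of_nonneg_left h5 (hγpos j).le
        rw [mul_sub, mul_sub, mul_div_cancel₀ _ (hγpos j).ne'] at h6
        linarith
      have h5 := Finset.sum_le_sum (s := Finset.univ) (fun j _ => h4 j)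
      rw [Finset.sum_sub_distrib, Finset.sum_sub_distrib, hcs, hγs] at h5
      linarith
    have h4 := hβ (k + 1)
    have h5 := hba k
    linarith
  have hFanti : Antitone F := antitone_nat_of_succ_le hstep
  have hFsub : Tendsto (F ∘ φ) atTop (nhds 0) := by
    have h1 : Tendsto (F ∘ φ) atTop (nhds (∑ i : Fin u, ∑ j : Fin v, (0 : ℝ))) := by
      refine tendsto_finsetSum _ (fun i _ => tendsto_finsetSum _ (fun j _ => ?_))
      by_cases hp : P i j = 0
      · simp [hp]
      · have hq : Q i j ≠ 0 := div_ne_zero hp (hγpos j).ne'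
        have h2 := (((tendsto_const_nhds (x := Q i j)).div (hTt i j) hq).log
          (div_ne_zero hq hq)).const_mul (P i j)
        rw [div_self hq, Real.log_one, mul_zero] at h2
        exact h2
    simpa using h1
  have hFt : Tendsto F atTop (nhds 0) :=
    (tendsto_iff_tendsto_subseq_of_antitone hFanti hφ.tendsto_atTop).2 hFsub
  have hFeq : ∀ k, F k = ∑ i, ∑ j, γ j * (Q i j * Real.log (Q i j / T k i j) - Q i j + T k i j) :=
    fun k => by
    have h1 : ∀ i j, γ j * (Q i j * Real.log (Q i j / T k i j) - Q i j + T k i j) =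
        P i j * Real.log (Q i j / T k i j) + γ j * (T k i j - Q i j) := fun i j => by
      have : P i j = γ j * Q i j := by
        simp only [hQ]; rw [mul_div_cancel₀ _ (hγpos j).ne']
      rw [this]; ring
    simp_rw [h1, Finset.sum_add_distrib]
    have h2 : ∑ i, ∑ j, γ j * (T k i j - Q i j) = 0 := by
      rw [Finset.sum_comm]
      refine Finset.sum_eq_zero (fun j _ => ?_)
      rw [← Finset.mul_sum, Finset.sum_sub_distrib, hcol, hQcol]
      ring
    rw [h2, add_zero]
  have hterm : ∀ k i j, (Real.sqrt (Q i j) - Real.sqrt (T k i j)) ^ 2 ≤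
      Q i j * Real.log (Q i j / T k i j) - Q i j + T k i j := fun k i j =>
    sk_kl_term _ _ (hQ0 i j) (hT0 k i j) (fun hq => (hPzT i j
      (fun hp => hq (by simp [hQ, hp])) k).ne')
  have hbound : ∀ k i j, m * (Real.sqrt (Q i j) - Real.sqrt (T k i j)) ^ 2 ≤ F k := fun k i j => by
    have hnn : ∀ i j, 0 ≤ γ j * (Q i j * Real.log (Q i j / T k i j) - Q i j + T k i j) :=
      fun i j => mul_nonneg (hγpos j).le ((sq_nonneg _).trans (hterm k i j))
    calc _ ≤ γ j * (Q i j * Real.log (Q i j / T k i j) - Q i j + T k i j) :=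
          mul_le_mul (hγm j) (hterm k i j) (sq_nonneg _) (hγpos j).le
      _ ≤ ∑ j, γ j * (Q i j * Real.log (Q i j / T k i j) - Q i j + T k i j) :=
          Finset.single_le_sum (f := fun j => γ j * (Q i j * Real.log (Q i j / T k i j)
            - Q i j + T k i j)) (fun j _ => hnn i j) (Finset.mem_univ j)
      _ ≤ ∑ i, ∑ j, γ j * (Q i j * Real.log (Q i j / T k i j) - Q i j + T k i j) :=
          Finset.single_le_sum (f := fun i => ∑ j, γ j * (Q i j * Real.log (Q i j / T k i j)
            - Q i j + T k i j)) (fun i _ => Finset.sum_nonneg (fun j _ => hnn i j))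
            (Finset.mem_univ i)
      _ = F k := (hFeq k).symm
  refine ⟨P, Q, φ, hφ, hPt, fun i j => rfl, hγm, fun i j => ?_⟩
  have h1 : Tendsto (fun k => m * (Real.sqrt (Q i j) - Real.sqrt (T k i j)) ^ 2) atTop (nhds 0) :=
    squeeze_zero (fun k => mul_nonneg hm.le (sq_nonneg _)) (fun k => hbound k i j) hFt
  have h2 : Tendsto (fun k => (Real.sqrt (Q i j) - Real.sqrt (T k i j)) ^ 2) atTop (nhds 0) := by
    have := h1.const_mul m⁻¹
    simpa [← mul_assoc, inv_mul_cancel₀ hm.ne'] using this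
  have h3 : Tendsto (fun k => |Real.sqrt (Q i j) - Real.sqrt (T k i j)|) atTop (nhds 0) := by
    have := h2.sqrt
    simpa [Real.sqrt_sq_eq_abs] using this
  have h4 := (tendsto_zero_iff_abs_tendsto_zero _).2 h3
  have h5 : Tendsto (fun k => Real.sqrt (T k i j)) atTop (nhds (Real.sqrt (Q i j))) := by
    have := (tendsto_const_nhds (x := Real.sqrt (Q i j))).sub h4
    simpa using this
  have h6 := h5.pow 2
  simpa [Real.sq_sqrt (hQ0 i j), Real.sq_sqrt (hT0 _ i j)] using h6

lemma sk_always {u v : ℕ} (M : Matrix (Fin u) (Fin v) ℝ) (hM : Admissible M) :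
    ∃ L T : Matrix (Fin u) (Fin v) ℝ,
        Stable L T ∧ EntrywiseLimit (skL M) L ∧ EntrywiseLimit (skT M) T := by
  obtain ⟨hM0, hMr, hMc⟩ := hM
  have hrs : ∀ i, 0 < ∑ j, M i j := fun i => by
    obtain ⟨j, hj⟩ := hMr i
    exact Finset.sum_pos' (fun j _ => hM0 i j)
      ⟨j, Finset.mem_univ j, lt_of_le_of_ne (hM0 i j) (Ne.symm hj)⟩
  have hT : ∀ k i j, skT M k i j = skL M k i j / ∑ i, skL M k i j := fun k i j => rfl
  have hL : ∀ k i j, skL M (k + 1) i j = skT M k i j / ∑ j, skT M k i j := fun k i j => rfl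
  have hL00 : ∀ i j, skL M 0 i j = M i j / ∑ j, M i j := fun i j => rfl
  have hc0 : ∀ j, 0 < ∑ i, skL M 0 i j := fun j => by
    obtain ⟨i, hi⟩ := hMc j
    exact Finset.sum_pos' (fun i _ => by rw [hL00]; exact div_nonneg (hM0 i j) (hrs i).le)
      ⟨i, Finset.mem_univ i, by
        rw [hL00]; exact div_pos (lt_of_le_of_ne (hM0 i j) (Ne.symm hi)) (hrs i)⟩
  obtain ⟨m, hm, hmc⟩ : ∃ m : ℝ, 0 < m ∧ ∀ j, m ≤ ∑ i, skL M 0 i j := by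
    rcases isEmpty_or_nonempty (Fin v) with h | h
    · exact ⟨1, one_pos, fun j => h.elim j⟩
    · obtain ⟨j0, hj0⟩ := Finite.exists_min (fun j => ∑ i, skL M 0 i j)
      exact ⟨_, hc0 j0, hj0⟩
  have hstepT : ∀ k, ((∀ i j, 0 ≤ skL M k i j) ∧ (∀ i, ∑ j, skL M k i j = 1) ∧
      ∀ j, m ≤ ∑ i, skL M k i j) → (∀ i j, 0 ≤ skT M k i j) ∧ (∀ i, (1 : ℝ) / u ≤ ∑ j, skT M k i j) ∧
      (∀ i, ∑ j, skT M k i j ≤ 1 / m) ∧ ∀ j, ∑ i, skT M k i j = 1 := by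
    rintro k ⟨h0, h1, h2⟩
    have hcu : ∀ j, ∑ i, skL M k i j ≤ u := fun j => by
      calc ∑ i, skL M k i j ≤ ∑ i : Fin u, (1 : ℝ) := Finset.sum_le_sum (fun i _ => by
            rw [← h1 i]
            exact Finset.single_le_sum (f := fun j => skL M k i j) (fun j _ => h0 i j)
              (Finset.mem_univ j))
        _ = u := by simp
    have hcp : ∀ j, 0 < ∑ i, skL M k i j := fun j => hm.trans_le (h2 j)
    refine ⟨fun i j => ?_, fun i => ?_, fun i => ?_, fun j => ?_⟩
    · rw [hT]; exact div_nonneg (h0 i j) (hcp j).le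
    · rw [← h1 i, Finset.sum_div]
      refine Finset.sum_le_sum (fun j _ => ?_)
      rw [hT]
      exact div_le_div_of_nonneg_left (h0 i j) (hcp j) (hcu j)
    · rw [← h1 i, Finset.sum_div]
      refine Finset.sum_le_sum (fun j _ => ?_)
      rw [hT]
      exact div_le_div_of_nonneg_left (h0 i j) hm (h2 j)
    · simp_rw [hT, ← Finset.sum_div]
      exact div_self (hcp j).ne'
  have hupos : ∀ i : Fin u, (0 : ℝ) < 1 / u := fun i => by
    have : 0 < u := Fin.pos i
    positivity
  have hinv : ∀ k, (∀ i j, 0 ≤ skL M k i j) ∧ (∀ i, ∑ j, skL M k i j = 1) ∧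
      ∀ j, m ≤ ∑ i, skL M k i j := by
    intro k
    induction k with
    | zero =>
      refine ⟨fun i j => ?_, fun i => ?_, hmc⟩
      · rw [hL00]; exact div_nonneg (hM0 i j) (hrs i).le
      · simp_rw [hL00, ← Finset.sum_div]
        exact div_self (hrs i).ne'
    | succ k ih =>
      obtain ⟨t0, t1, t2, t3⟩ := hstepT k ih
      have hrp : ∀ i, 0 < ∑ j, skT M k i j := fun i => (hupos i).trans_le (t1 i)
      refine ⟨fun i j => ?_, fun i => ?_, fun j => ?_⟩
      · rw [hL]; exact div_nonneg (t0 i j) (hrp i).le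
      · simp_rw [hL, ← Finset.sum_div]
        exact div_self (hrp i).ne'
      · calc m = ∑ i, m * skT M k i j := by rw [← Finset.mul_sum, t3, mul_one]
          _ ≤ ∑ i, skL M (k + 1) i j := Finset.sum_le_sum (fun i _ => by
            rw [hL, le_div_iff₀ (hrp i)]
            have h1 := mul_le_mul_of_nonneg_left (t2 i) hm.le
            rw [mul_one_div_cancel hm.ne'] at h1
            calc m * skT M k i j * ∑ j, skT M k i j
                = (m * ∑ j, skT M k i j) * skT M k i j := by ring
              _ ≤ 1 * skT M k i j := mul_le_mul_of_nonneg_right h1 (t0 i j)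
              _ = _ := one_mul _)
  have hr1 : ∀ k i, (1 : ℝ) / u ≤ ∑ j, skT M k i j := fun k => (hstepT k (hinv k)).2.1
  obtain ⟨P, Q, φ, hφ, hP, hQ, hPm, hTQ⟩ := sk_core (skL M) (skT M) (fun k j => ∑ i, skL M k i j)
    (fun k i => ∑ j, skT M k i j) m hm (fun _ _ => rfl) (fun _ _ => rfl)
    (fun k => (hinv k).1) (fun k => (hinv k).2.1) (fun k => (hinv k).2.2)
    (fun k i => (hupos i).trans_le (hr1 k i)) hT hL
  have hrt : ∀ i, Tendsto (fun k => ∑ j, skT M k i j) atTop (nhds (∑ j, Q i j)) := fun i =>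
    tendsto_finsetSum _ (fun j _ => hTQ i j)
  have hrQ : ∀ i, 0 < ∑ j, Q i j := fun i =>
    (hupos i).trans_le (ge_of_tendsto' (hrt i) (fun k => hr1 k i))
  have hLt : ∀ i j, Tendsto (fun k => skL M k i j) atTop (nhds (Q i j / ∑ j, Q i j)) :=
    fun i j => by
    rw [← tendsto_add_atTop_iff_nat 1]
    exact (hTQ i j).div (hrt i) (hrQ i).ne'
  have hPQ : ∀ i j, P i j = Q i j / ∑ j, Q i j := fun i j =>
    tendsto_nhds_unique (hP i j) ((hLt i j).comp hφ.tendsto_atTop)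
  refine ⟨P, Q, ⟨?_, ?_⟩, fun i j => ?_, hTQ⟩
  · ext i j; exact (hQ i j).symm
  · ext i j; exact (hPQ i j).symm
  · rw [hPQ]; exact hLt i j

/-- An admissible matrix converges under SK iteration to a stable pair iff
there exists a stable pair (P,Q) with P ≺ M. -/
theorem sinkhorn_converges_iff_exists_stable_subpattern (u v : ℕ)
    (M : Matrix (Fin u) (Fin v) ℝ) (hM : Admissible M) :
    (∃ L T : Matrix (Fin u) (Fin v) ℝ,
        Stable L T ∧ EntrywiseLimit (skL M) L ∧ EntrywiseLimit (skT M) T) ↔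
    (∃ P Q : Matrix (Fin u) (Fin v) ℝ, Stable P Q ∧ PartialPattern P M) := by
  constructor
  · rintro ⟨L, T, hS, hL, -⟩
    refine ⟨L, T, hS, fun i j h => ?_⟩
    have hz : ∀ k, skL M k i j = 0 := by
      intro k
      induction k with
      | zero => simp [skL, rowNorm, h]
      | succ k ih => simp [skL, rowNorm, colNorm, ih]
    have h1 := hL i j
    simp_rw [hz] at h1
    exact tendsto_nhds_unique h1 tendsto_const_nhds
  · intro _
    exact sk_always M hM
end

section
/- Let (P,Q) be a stable pair of admissible u×v matrices. Then there exist a permutation of the rows and a permutation of the columns bringing P to block-diagonal form diag(B_1, …, B_k), where each block B_i is a u_i×v_i matrix all of whose row sums equal 1 and all of whose column sums equal the constant c_i = u_i/v_i. -/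
open Matrix Filter

/-- A stable pair of admissible matrices is, up to row and column
permutations, block diagonal, with each block having row sums 1 and constant column sums
`uᵢ/vᵢ`.  This is formalized via a partition of the rows and of the columns into `k`
nonempty blocks (indexed by `Fin k` through the block-assignment maps `rb`, `cb`)
outside of which `P` vanishes. -/
theorem stable_pair_block_diagonal (u v : ℕ) (P Q : Matrix (Fin u) (Fin v) ℝ)
    (hP : Admissible P) (hQ : Admissible Q) (hPQ : Stable P Q) :
    ∃ (k : ℕ) (rb : Fin u → Fin k) (cb : Fin v → Fin k),
      Function.Surjective rb ∧ Function.Surjective cb ∧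
      (∀ i j, P i j ≠ 0 → rb i = cb j) ∧
      (∀ i : Fin u, ∑ j ∈ Finset.univ.filter (fun j => cb j = rb i), P i j = 1) ∧
      (∀ j : Fin v, ∑ i ∈ Finset.univ.filter (fun i => rb i = cb j), P i j =
        (Nat.card {i : Fin u // rb i = cb j} : ℝ) /
          (Nat.card {j' : Fin v // cb j' = cb j} : ℝ)) := by
  classical
  obtain ⟨hC, hR⟩ := hPQ
  obtain ⟨hP0, hPr, hPc⟩ := hP
  obtain ⟨hQ0, hQr, hQc⟩ := hQ
  let c : Fin v → ℝ := fun j => ∑ k, P k j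
  let r : Fin u → ℝ := fun i => ∑ k, Q i k
  have hr : ∀ i, 0 < r i := by
    intro i
    obtain ⟨j, hj⟩ := hQr i
    exact Finset.sum_pos' (fun k _ => hQ0 i k)
      ⟨j, Finset.mem_univ j, lt_of_le_of_ne (hQ0 i j) (Ne.symm hj)⟩
  have hQe : ∀ i j, Q i j = P i j / c j := by
    intro i j
    rw [← hC]; rfl
  have hPe : ∀ i j, P i j = Q i j / r i := by
    intro i j
    conv_lhs => rw [← hR]
    rfl
  have hrow : ∀ i, ∑ j, P i j = 1 := by
    intro i
    simp_rw [hPe i]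
    rw [← Finset.sum_div]
    exact div_self (hr i).ne'
  have hkey : ∀ i j, P i j ≠ 0 → (r i)⁻¹ = c j := by
    intro i j h
    have h1 := hPe i j
    rw [hQe] at h1
    have hcj : c j ≠ 0 := by
      intro h0
      rw [h0] at h1
      simp at h1
      exact h h1
    have := (hr i).ne'
    field_simp at h1 ⊢
    linarith
  let S : Finset ℝ := Finset.univ.image c
  have hcS : ∀ j, c j ∈ S := fun j => Finset.mem_image_of_mem _ (Finset.mem_univ j)
  have hrS : ∀ i, (r i)⁻¹ ∈ S := by
    intro i
    obtain ⟨j, hj⟩ := hPr i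
    rw [hkey i j hj]
    exact hcS j
  let rb : Fin u → Fin S.card := fun i => S.equivFin ⟨(r i)⁻¹, hrS i⟩
  let cb : Fin v → Fin S.card := fun j => S.equivFin ⟨c j, hcS j⟩
  have hb : ∀ i j, P i j ≠ 0 → rb i = cb j := by
    intro i j h
    simp only [rb, cb, hkey i j h]
  have hcc : ∀ j j', cb j = cb j' → c j = c j' := by
    intro j j' h
    simpa [cb] using h
  have hcsurj : Function.Surjective cb := by
    intro b
    obtain ⟨⟨x, hx⟩, rfl⟩ := S.equivFin.surjective b
    obtain ⟨j, _, rfl⟩ := Finset.mem_image.1 hx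
    exact ⟨j, rfl⟩
  have hrsurj : Function.Surjective rb := by
    intro b
    obtain ⟨j, rfl⟩ := hcsurj b
    obtain ⟨i, hi⟩ := hPc j
    exact ⟨i, hb i j hi⟩
  have hrow' : ∀ i, ∑ j ∈ Finset.univ.filter (fun j => cb j = rb i), P i j = 1 := by
    intro i
    rw [← hrow i, Finset.sum_filter_of_ne]
    intro j _ h
    exact (hb i j h).symm
  have hcol' : ∀ j, ∑ i ∈ Finset.univ.filter (fun i => rb i = cb j), P i j = c j := by
    intro j
    rw [Finset.sum_filter_of_ne]
    intro i _ h
    exact hb i j h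
  refine ⟨S.card, rb, cb, hrsurj, hcsurj, hb, hrow', ?_⟩
  intro j
  rw [hcol' j, Nat.card_eq_fintype_card, Nat.card_eq_fintype_card, Fintype.card_subtype,
    Fintype.card_subtype]
  have hpos : 0 < (Finset.univ.filter (fun j' => cb j' = cb j)).card :=
    Finset.card_pos.2 ⟨j, by simp⟩
  rw [eq_div_iff (by exact_mod_cast hpos.ne')]
  have e1 : ∑ i ∈ Finset.univ.filter (fun i => rb i = cb j),
      ∑ j' ∈ Finset.univ.filter (fun j' => cb j' = cb j), P i j'
      = ((Finset.univ.filter (fun i => rb i = cb j)).card : ℝ) := by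
    rw [Finset.sum_congr rfl (g := fun _ => (1 : ℝ))]
    · simp
    · intro i hi
      rw [← (Finset.mem_filter.1 hi).2]
      exact hrow' i
  have e2 : ∑ j' ∈ Finset.univ.filter (fun j' => cb j' = cb j),
      ∑ i ∈ Finset.univ.filter (fun i => rb i = cb j), P i j'
      = ((Finset.univ.filter (fun j' => cb j' = cb j)).card : ℝ) * c j := by
    rw [Finset.sum_congr rfl (g := fun _ => c j)]
    · simp
    · intro j' hj
      have h := (Finset.mem_filter.1 hj).2
      rw [← h, hcol' j']
      exact hcc _ _ h
  have e3 := (e1.symm.trans Finset.sum_comm).trans e2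
  exact (mul_comm _ _).trans e3.symm
end

section
/- Let M be an admissible n×n matrix possessing at least one positive diagonal, and suppose its Sinkhorn iteration converges to the doubly stochastic matrix Φ(M). Then for any n×n doubly stochastic matrix L, Φ(M) = L if and only if M is cross ratio equivalent to L. -/
open Matrix Filter

theorem birkhoff_aux {n : ℕ} {P : Matrix (Fin n) (Fin n) ℝ} (hP : DoublyStochastic P) :
    ∃ w : Equiv.Perm (Fin n) → ℝ, (∀ σ, 0 ≤ w σ) ∧ ∑ σ, w σ = 1 ∧
      ∀ i j, P i j = ∑ σ, w σ * (if σ i = j then 1 else 0) := by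
  have hmem : P ∈ doublyStochastic ℝ (Fin n) := by
    rw [mem_doublyStochastic_iff_sum]
    exact hP
  obtain ⟨w, h0, h1, h2⟩ := exists_eq_sum_perm_of_mem_doublyStochastic hmem
  refine ⟨w, h0, h1, fun i j => ?_⟩
  rw [← h2, Matrix.sum_apply]
  refine Finset.sum_congr rfl fun σ _ => ?_
  rw [Matrix.smul_apply, Equiv.Perm.permMatrix, PEquiv.toMatrix_apply, smul_eq_mul]
  simp [Equiv.toPEquiv_apply, eq_comm]

theorem weight_pos_aux {n : ℕ} {P : Matrix (Fin n) (Fin n) ℝ} {w : Equiv.Perm (Fin n) → ℝ}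
    (h0 : ∀ σ, 0 ≤ w σ) (h : ∀ i j, P i j = ∑ σ, w σ * (if σ i = j then 1 else 0))
    (σ : Equiv.Perm (Fin n)) (hw : w σ ≠ 0) (i : Fin n) : 0 < P i (σ i) := by
  have hpos : 0 < w σ := lt_of_le_of_ne (h0 σ) (Ne.symm hw)
  rw [h]
  refine Finset.sum_pos' (fun τ _ => ?_) ⟨σ, Finset.mem_univ _, by simpa using hpos⟩
  split_ifs <;> simp [h0 τ]

theorem sum_weight_aux {n : ℕ} {P : Matrix (Fin n) (Fin n) ℝ} {w : Equiv.Perm (Fin n) → ℝ}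
    (h : ∀ i j, P i j = ∑ σ, w σ * (if σ i = j then 1 else 0))
    (X : Fin n → Fin n → ℝ) :
    ∑ i, ∑ j, P i j * X i j = ∑ σ, w σ * ∑ i, X i (σ i) := by
  simp only [h, Finset.sum_mul, Finset.mul_sum]
  rw [Finset.sum_comm (s := (Finset.univ : Finset (Equiv.Perm (Fin n))))]
  refine Finset.sum_congr rfl fun i _ => ?_
  rw [Finset.sum_comm]
  refine Finset.sum_congr rfl fun σ _ => ?_
  simp

/-- Logarithmic divergence against a doubly stochastic matrix. -/
theorem log_sum_aux {n : ℕ} {R P Q : Matrix (Fin n) (Fin n) ℝ} (hR : DoublyStochastic R) (t : ℝ)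
    (hsP : ∀ σ, diagProd R σ ≠ 0 → diagProd P σ ≠ 0)
    (hsQ : ∀ σ, diagProd R σ ≠ 0 → diagProd Q σ ≠ 0) (ht : t ≠ 0)
    (hPQ : ∀ σ, diagProd P σ = t * diagProd Q σ) :
    ∑ i, ∑ j, R i j * (Real.log (P i j) - Real.log (Q i j)) = Real.log t := by
  obtain ⟨w, h0, h1, h⟩ := birkhoff_aux hR
  rw [sum_weight_aux h]
  have : ∀ σ, w σ * ∑ i, (Real.log (P i (σ i)) - Real.log (Q i (σ i))) = w σ * Real.log t := by
    intro σ
    by_cases hw : w σ = 0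
    · simp [hw]
    have hr : diagProd R σ ≠ 0 :=
      Finset.prod_ne_zero_iff.2 fun i _ => (weight_pos_aux h0 h σ hw i).ne'
    have hp := hsP σ hr
    have hq := hsQ σ hr
    have e := congrArg Real.log (hPQ σ)
    rw [Real.log_mul ht hq] at e
    unfold diagProd at e hp hq
    rw [Real.log_prod (fun i hi => Finset.prod_ne_zero_iff.1 hp i hi),
      Real.log_prod (fun i hi => Finset.prod_ne_zero_iff.1 hq i hi)] at e
    rw [Finset.sum_sub_distrib, e]
    ring
  rw [Finset.sum_congr rfl fun σ _ => this σ, ← Finset.sum_mul, h1, one_mul]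

theorem support_aux {n : ℕ} {P Q : Matrix (Fin n) (Fin n) ℝ} (hP : DoublyStochastic P)
    (hs : ∀ σ, diagProd P σ ≠ 0 → diagProd Q σ ≠ 0) (i j : Fin n) (hij : P i j ≠ 0) :
    Q i j ≠ 0 := by
  obtain ⟨w, h0, h1, h⟩ := birkhoff_aux hP
  rw [h] at hij
  obtain ⟨σ, -, hσ⟩ := Finset.exists_ne_zero_of_sum_ne_zero hij
  have hw : w σ ≠ 0 := left_ne_zero_of_mul hσ
  have hj : σ i = j := by
    by_contra hc
    simp [hc] at hσ
  have hr : diagProd P σ ≠ 0 :=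
    Finset.prod_ne_zero_iff.2 fun i _ => (weight_pos_aux h0 h σ hw i).ne'
  have := Finset.prod_ne_zero_iff.1 (hs σ hr) i (Finset.mem_univ _)
  rwa [hj] at this

theorem unique_aux {n : ℕ} {P Q : Matrix (Fin n) (Fin n) ℝ} (hP : DoublyStochastic P)
    (hQ : DoublyStochastic Q) (t : ℝ) (ht : t ≠ 0)
    (hPQ : ∀ σ, diagProd P σ = t * diagProd Q σ) : P = Q := by
  have s1 : ∀ σ, diagProd P σ ≠ 0 → diagProd Q σ ≠ 0 := by
    intro σ h
    rw [hPQ] at h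
    exact right_ne_zero_of_mul h
  have s2 : ∀ σ, diagProd Q σ ≠ 0 → diagProd P σ ≠ 0 := by
    intro σ h
    rw [hPQ]
    exact mul_ne_zero ht h
  have e1 := log_sum_aux hP t (fun _ => id) s1 ht hPQ
  have e2 := log_sum_aux hQ t s2 (fun _ => id) ht hPQ
  have e3 : ∑ i, ∑ j, (P i j - Q i j) * (Real.log (P i j) - Real.log (Q i j)) = 0 := by
    simp only [sub_mul (P _ _), Finset.sum_sub_distrib]
    rw [e1, e2, sub_self]
  have key : ∀ i j, 0 ≤ (P i j - Q i j) * (Real.log (P i j) - Real.log (Q i j)) ∧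
      ((P i j - Q i j) * (Real.log (P i j) - Real.log (Q i j)) = 0 → P i j = Q i j) := by
    intro i j
    by_cases hp : P i j = 0
    · have hq : Q i j = 0 := by
        by_contra hq
        exact support_aux hQ s2 i j hq hp
      simp [hp, hq]
    · have hq := support_aux hP s1 i j hp
      have pp : 0 < P i j := lt_of_le_of_ne (hP.1 i j) (Ne.symm hp)
      have qp : 0 < Q i j := lt_of_le_of_ne (hQ.1 i j) (Ne.symm hq)
      rcases lt_trichotomy (P i j) (Q i j) with hlt | heq | hlt
      · have := Real.log_lt_log pp hlt
        have : 0 < (P i j - Q i j) * (Real.log (P i j) - Real.log (Q i j)) :=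
          mul_pos_of_neg_of_neg (by linarith) (by linarith)
        exact ⟨this.le, fun h => absurd h this.ne'⟩
      · simp [heq]
      · have := Real.log_lt_log qp hlt
        have : 0 < (P i j - Q i j) * (Real.log (P i j) - Real.log (Q i j)) :=
          mul_pos (by linarith) (by linarith)
        exact ⟨this.le, fun h => absurd h this.ne'⟩
  ext i j
  have a := (Finset.sum_eq_zero_iff_of_nonneg
    (fun i _ => Finset.sum_nonneg fun j _ => (key i j).1)).1 e3 i (Finset.mem_univ _)
  have b := (Finset.sum_eq_zero_iff_of_nonneg (fun j _ => (key i j).1)).1 a j (Finset.mem_univ _)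
  exact (key i j).2 b

/-- `A` is a positive diagonal scaling of `M`. -/
def ScaledAux {n : ℕ} (M A : Matrix (Fin n) (Fin n) ℝ) : Prop :=
  ∃ r c : Fin n → ℝ, (∀ i, 0 < r i) ∧ (∀ j, 0 < c j) ∧ ∀ i j, A i j = r i * M i j * c j

theorem ScaledAux.row {n : ℕ} {M A : Matrix (Fin n) (Fin n) ℝ} (hM : Admissible M)
    (h : ScaledAux M A) : ScaledAux M (rowNorm A) := by
  obtain ⟨r, c, hr, hc, h⟩ := h
  have hs : ∀ i, 0 < ∑ k, A i k := by
    intro i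
    obtain ⟨j, hj⟩ := hM.2.1 i
    have hj' := lt_of_le_of_ne (hM.1 i j) (Ne.symm hj)
    refine Finset.sum_pos' (fun k _ => ?_) ⟨j, Finset.mem_univ _, ?_⟩
    · rw [h]; exact mul_nonneg (mul_nonneg (hr i).le (hM.1 i k)) (hc k).le
    · rw [h]; exact mul_pos (mul_pos (hr i) hj') (hc j)
  refine ⟨fun i => r i / ∑ k, A i k, c, fun i => div_pos (hr i) (hs i), hc, fun i j => ?_⟩
  simp only [rowNorm, Matrix.of_apply]
  rw [h i j]
  ring

theorem ScaledAux.col {n : ℕ} {M A : Matrix (Fin n) (Fin n) ℝ} (hM : Admissible M)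
    (h : ScaledAux M A) : ScaledAux M (colNorm A) := by
  obtain ⟨r, c, hr, hc, h⟩ := h
  have hs : ∀ j, 0 < ∑ k, A k j := by
    intro j
    obtain ⟨i, hi⟩ := hM.2.2 j
    have hi' := lt_of_le_of_ne (hM.1 i j) (Ne.symm hi)
    refine Finset.sum_pos' (fun k _ => ?_) ⟨i, Finset.mem_univ _, ?_⟩
    · rw [h]; exact mul_nonneg (mul_nonneg (hr k).le (hM.1 k j)) (hc j).le
    · rw [h]; exact mul_pos (mul_pos (hr i) hi') (hc j)
  refine ⟨r, fun j => c j / ∑ k, A k j, hr, fun j => div_pos (hc j) (hs j), fun i j => ?_⟩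
  simp only [colNorm, Matrix.of_apply]
  rw [h i j]
  ring

theorem scaled_skL_aux {n : ℕ} {M : Matrix (Fin n) (Fin n) ℝ} (hM : Admissible M) (k : ℕ) :
    ScaledAux M (skL M k) := by
  induction k with
  | zero =>
    have : ScaledAux M M := ⟨fun _ => 1, fun _ => 1, by simp, by simp, by simp⟩
    exact this.row hM
  | succ k ih => exact (ih.col hM).row hM

theorem ScaledAux.diag {n : ℕ} {M A : Matrix (Fin n) (Fin n) ℝ} (h : ScaledAux M A) :
    ∃ s : ℝ, ∀ σ, diagProd A σ = s * diagProd M σ := by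
  obtain ⟨r, c, -, -, h⟩ := h
  refine ⟨(∏ i, r i) * ∏ j, c j, fun σ => ?_⟩
  unfold diagProd
  simp only [h, Finset.prod_mul_distrib]
  rw [Equiv.prod_comp σ c]
  ring

theorem limit_diag_aux {n : ℕ} {M P : Matrix (Fin n) (Fin n) ℝ}
    (hM : Admissible M) (hpd : HasPosDiag M) (hDS : DoublyStochastic P)
    (hL : EntrywiseLimit (skL M) P) :
    ∃ s : ℝ, s ≠ 0 ∧ ∀ σ, diagProd P σ = s * diagProd M σ := by
  choose s hs using fun k => (scaled_skL_aux hM k).diag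
  have lim : ∀ σ, Tendsto (fun k => s k * diagProd M σ) atTop (nhds (diagProd P σ)) := by
    intro σ
    simp only [← hs]
    exact tendsto_finsetProd _ fun i _ => hL i (σ i)
  obtain ⟨σ0, h0⟩ := hpd
  have hm : diagProd M σ0 ≠ 0 := (Finset.prod_pos fun i _ => h0 i).ne'
  have lims : Tendsto s atTop (nhds (diagProd P σ0 / diagProd M σ0)) := by
    have := (lim σ0).div_const (diagProd M σ0)
    simpa [hm] using this
  have eq : ∀ σ, diagProd P σ = diagProd P σ0 / diagProd M σ0 * diagProd M σ := fun σ =>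
    tendsto_nhds_unique (lim σ) (lims.mul_const _)
  refine ⟨_, ?_, eq⟩
  intro hz
  obtain ⟨w, w0, w1, h⟩ := birkhoff_aux hDS
  obtain ⟨σ, -, hσ⟩ := Finset.exists_ne_zero_of_sum_ne_zero (w1.trans_ne one_ne_zero)
  have hr : diagProd P σ ≠ 0 :=
    Finset.prod_ne_zero_iff.2 fun i _ => (weight_pos_aux w0 h σ hσ i).ne'
  rw [eq, hz, zero_mul] at hr
  exact hr rfl

/-- For an admissible square matrix M with a positive diagonal whose
Sinkhorn iteration converges to the doubly stochastic matrix Φ(M), one has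
Φ(M) = L iff M is cross ratio equivalent to L, for any doubly stochastic L. -/
theorem sinkhorn_limit_eq_iff_crossRatioEquiv (n : ℕ) (M PhiM : Matrix (Fin n) (Fin n) ℝ)
    (hM : Admissible M) (hpd : HasPosDiag M) (hDS : DoublyStochastic PhiM)
    (hL : EntrywiseLimit (skL M) PhiM) (hT : EntrywiseLimit (skT M) PhiM) :
    ∀ L : Matrix (Fin n) (Fin n) ℝ, DoublyStochastic L →
      (PhiM = L ↔ CrossRatioEquiv M L) := by
  intro L hLD
  obtain ⟨s, hs, hd⟩ := limit_diag_aux hM hpd hDS hL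
  constructor
  · rintro rfl
    refine ⟨fun σ => ?_, fun σ σ' _ _ => ?_⟩
    · rw [hd]; simp [hs]
    · rw [hd, hd, mul_div_mul_left _ _ hs]
  · rintro ⟨c1, c2⟩
    obtain ⟨σ0, h0⟩ := hpd
    have hm : diagProd M σ0 ≠ 0 := (Finset.prod_pos fun i _ => h0 i).ne'
    have hl := (c1 σ0).1 hm
    refine unique_aux hDS hLD (s * (diagProd M σ0 / diagProd L σ0))
      (mul_ne_zero hs (div_ne_zero hm hl)) fun σ => ?_
    rw [hd, mul_assoc]
    congr 1
    by_cases h : diagProd M σ = 0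
    · have : diagProd L σ = 0 := by
        by_contra hc
        exact (c1 σ).2 hc h
      rw [h, this, mul_zero]
    · have := c2 σ σ0 h hm
      field_simp at this ⊢
      linarith
end

section
/- Let M be an admissible n×n matrix with at least one positive diagonal, and let M^ε be obtained from M by replacing the entry m_{st} with m_{st} + ε for some ε > 0, where the entry at position (s,t) is off-diagonal both in M and in M^ε (i.e., contained in no positive diagonal of either matrix). Then the Sinkhorn limits of M and M^ε coincide, and in particular CI(M) = CI(M^ε). -/
open Matrix Filter

lemma aux_prod_le_one {n : ℕ} (x : Fin n → ℝ) (h0 : ∀ j, 0 ≤ x j) (hs : ∑ j, x j = n) :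
    ∏ j, x j ≤ 1 := by
  calc ∏ j, x j ≤ ∏ j, Real.exp (x j - 1) := by
        apply Finset.prod_le_prod (fun j _ => h0 j)
        intro j _
        linarith [Real.add_one_le_exp (x j - 1)]
    _ = Real.exp (∑ j, (x j - 1)) := (Real.exp_sum _ _).symm
    _ = 1 := by simp [hs]

lemma aux_eq_one {n : ℕ} (x : Fin n → ℝ) (h0 : ∀ j, 0 ≤ x j) (hs : ∑ j, x j = n)
    (hp : 1 ≤ ∏ j, x j) : ∀ j, x j = 1 := by
  have hpos : ∀ j, 0 < x j := by
    intro j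
    rcases (h0 j).lt_or_eq with h | h
    · exact h
    · rw [Finset.prod_eq_zero (Finset.mem_univ j) h.symm] at hp
      linarith
  have hlog : 0 ≤ ∑ j, Real.log (x j) := by
    rw [← Real.log_prod (fun j _ => (hpos j).ne')]
    exact Real.log_nonneg hp
  have hle : ∀ j ∈ Finset.univ, Real.log (x j) ≤ x j - 1 := fun j _ =>
    Real.log_le_sub_one_of_pos (hpos j)
  have hsum : ∑ j, (x j - 1) = 0 := by simp [hs]
  have heq := (Finset.sum_eq_sum_iff_of_le hle).1
    (le_antisymm (Finset.sum_le_sum hle) (by rw [hsum]; exact hlog))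
  intro j
  by_contra hne
  exact absurd (heq j (Finset.mem_univ j)) (Real.log_lt_sub_one_of_pos (hpos j) hne).ne

lemma diagProd_pos_entry {n : ℕ} {A : Matrix (Fin n) (Fin n) ℝ} (hA : ∀ i j, 0 ≤ A i j)
    {σ : Equiv.Perm (Fin n)} (h : 0 < diagProd A σ) (i : Fin n) : 0 < A i (σ i) := by
  rcases (hA i (σ i)).lt_or_eq with h' | h'
  · exact h'
  · unfold diagProd at h
    rw [Finset.prod_eq_zero (Finset.mem_univ i) h'.symm] at h
    exact absurd h (lt_irrefl _)

/-- Relative entropy comparison of doubly stochastic matrices with proportional diagonals. -/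
lemma aux_half {n : ℕ} {L L' : Matrix (Fin n) (Fin n) ℝ} (hL : DoublyStochastic L)
    (hL' : DoublyStochastic L') (r : ℝ) (hr : 0 < r)
    (h : ∀ σ, diagProd L' σ = r * diagProd L σ) :
    Real.log r ≤ 0 ∧ (Real.log r = 0 → L' = L) := by
  obtain ⟨w, hw0, hw1, hw⟩ :=
    exists_eq_sum_perm_of_mem_doublyStochastic (mem_doublyStochastic_iff_sum.2 hL)
  have hent : ∀ i j, L i j = ∑ σ : Equiv.Perm (Fin n), w σ * (if σ i = j then 1 else 0) := by
    intro i j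
    rw [← hw, Matrix.sum_apply]
    apply Finset.sum_congr rfl
    intro σ _
    simp [Equiv.Perm.permMatrix, PEquiv.toMatrix_apply, eq_comm]
  have hwpos : ∀ σ, 0 < w σ → ∀ i, 0 < L i (σ i) := by
    intro σ hσ i
    rw [hent]
    refine lt_of_lt_of_le hσ ?_
    have := Finset.single_le_sum
      (f := fun τ : Equiv.Perm (Fin n) => w τ * (if τ i = σ i then (1:ℝ) else 0))
      (fun τ _ => mul_nonneg (hw0 τ) (by split_ifs <;> norm_num)) (Finset.mem_univ σ)
    simpa using this
  have hwpos' : ∀ σ, 0 < w σ → ∀ i, 0 < L' i (σ i) := by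
    intro σ hσ i
    apply diagProd_pos_entry hL'.1
    rw [h]
    exact mul_pos hr (Finset.prod_pos fun i _ => hwpos σ hσ i)
  have hsupp : ∀ i j, 0 < L i j → 0 < L' i j := by
    intro i j hij
    rw [hent] at hij
    obtain ⟨σ, -, hσ⟩ := Finset.exists_lt_of_sum_lt
      (s := Finset.univ) (f := fun _ : Equiv.Perm (Fin n) => (0:ℝ)) (by simpa using hij)
    by_cases hc : σ i = j
    · simp only [hc, if_true, mul_one] at hσ
      rw [← hc]
      exact hwpos' σ hσ i
    · simp [hc] at hσ
  have hsum : ∑ i, ∑ j, L i j * (Real.log (L' i j) - Real.log (L i j)) = Real.log r := by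
    calc ∑ i, ∑ j, L i j * (Real.log (L' i j) - Real.log (L i j))
        = ∑ i, ∑ σ : Equiv.Perm (Fin n),
            w σ * (Real.log (L' i (σ i)) - Real.log (L i (σ i))) := by
          apply Finset.sum_congr rfl
          intro i _
          have : ∀ j, L i j * (Real.log (L' i j) - Real.log (L i j))
              = ∑ σ : Equiv.Perm (Fin n), (if σ i = j then
                w σ * (Real.log (L' i j) - Real.log (L i j)) else 0) := by
            intro j
            conv_lhs => rw [hent i j, Finset.sum_mul]
            apply Finset.sum_congr rfl
            intro σ _
            rw [← hent i j]
            split_ifs <;> simp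
          simp_rw [this]
          rw [Finset.sum_comm]
          simp
      _ = ∑ σ : Equiv.Perm (Fin n), w σ *
            ∑ i, (Real.log (L' i (σ i)) - Real.log (L i (σ i))) := by
          rw [Finset.sum_comm]
          simp_rw [Finset.mul_sum]
      _ = ∑ σ : Equiv.Perm (Fin n), w σ * Real.log r := by
          apply Finset.sum_congr rfl
          intro σ _
          rcases (hw0 σ).lt_or_eq with hσ | hσ
          · congr 1
            rw [Finset.sum_sub_distrib,
              ← Real.log_prod (fun i _ => (hwpos' σ hσ i).ne'),
              ← Real.log_prod (fun i _ => (hwpos σ hσ i).ne')]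
            have h1 := h σ
            have h2 : 0 < diagProd L σ := Finset.prod_pos fun i _ => hwpos σ hσ i
            unfold diagProd at h1 h2
            rw [h1, Real.log_mul hr.ne' h2.ne']
            ring
          · simp [← hσ]
      _ = Real.log r := by rw [← Finset.sum_mul, hw1, one_mul]
  have key : ∀ i j, 0 < L i j → L i j * (Real.log (L' i j) - Real.log (L i j))
      = L i j * Real.log (L' i j / L i j) := by
    intro i j hij
    rw [Real.log_div (hsupp i j hij).ne' hij.ne']
  have key2 : ∀ i j, 0 < L i j → L' i j - L i j = L i j * (L' i j / L i j - 1) := by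
    intro i j hij
    field_simp
  have hle : ∀ p ∈ (Finset.univ : Finset (Fin n × Fin n)),
      L p.1 p.2 * (Real.log (L' p.1 p.2) - Real.log (L p.1 p.2)) ≤ L' p.1 p.2 - L p.1 p.2 := by
    rintro ⟨i, j⟩ -
    rcases (hL.1 i j).lt_or_eq with hij | hij
    · simp only
      rw [key i j hij, key2 i j hij]
      exact mul_le_mul_of_nonneg_left
        (Real.log_le_sub_one_of_pos (div_pos (hsupp i j hij) hij)) hij.le
    · simp [← hij, hL'.1 i j]
  have hsum1 : ∑ p : Fin n × Fin n,
      L p.1 p.2 * (Real.log (L' p.1 p.2) - Real.log (L p.1 p.2)) = Real.log r := by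
    rw [Fintype.sum_prod_type]; exact hsum
  have hsum2 : ∑ p : Fin n × Fin n, (L' p.1 p.2 - L p.1 p.2) = 0 := by
    rw [Fintype.sum_prod_type]
    simp [hL.2.1, hL'.2.1]
  refine ⟨?_, ?_⟩
  · rw [← hsum1, ← hsum2]
    exact Finset.sum_le_sum hle
  · intro hr1
    have heq := (Finset.sum_eq_sum_iff_of_le hle).1 (by rw [hsum1, hsum2, hr1])
    ext i j
    have hij := heq (i, j) (Finset.mem_univ _)
    simp only at hij
    rcases (hL.1 i j).lt_or_eq with hp | hp
    · rw [key i j hp, key2 i j hp] at hij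
      have h1 := mul_left_cancel₀ hp.ne' hij
      by_contra hne
      refine absurd h1 (Real.log_lt_sub_one_of_pos (div_pos (hsupp i j hp) hp) ?_).ne
      intro h2
      exact hne (by rwa [div_eq_one_iff_eq hp.ne'] at h2)
    · rw [← hp] at hij ⊢
      linarith

lemma ds_unique {n : ℕ} {L L' : Matrix (Fin n) (Fin n) ℝ} (hL : DoublyStochastic L)
    (hL' : DoublyStochastic L') (r : ℝ) (hr : 0 < r)
    (h : ∀ σ, diagProd L' σ = r * diagProd L σ) : L' = L := by
  have h1 := aux_half hL hL' r hr h
  have h2 := aux_half hL' hL r⁻¹ (inv_pos.2 hr) (fun σ => by rw [h σ]; field_simp)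
  rw [Real.log_inv] at h2
  exact h1.2 (le_antisymm h1.1 (by linarith [h2.1]))

/-- Nonnegative matrices whose diagonal given by `σ` is positive. -/
def GoodM {n : ℕ} (τ : Equiv.Perm (Fin n)) (A : Matrix (Fin n) (Fin n) ℝ) : Prop :=
  (∀ i j, 0 ≤ A i j) ∧ ∀ i, 0 < A i (τ i)

lemma GoodM.row_pos {n : ℕ} {τ : Equiv.Perm (Fin n)} {A : Matrix (Fin n) (Fin n) ℝ}
    (h : GoodM τ A) (i : Fin n) : 0 < ∑ k, A i k :=
  Finset.sum_pos' (fun k _ => h.1 i k) ⟨τ i, Finset.mem_univ _, h.2 i⟩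

lemma GoodM.col_pos {n : ℕ} {τ : Equiv.Perm (Fin n)} {A : Matrix (Fin n) (Fin n) ℝ}
    (h : GoodM τ A) (j : Fin n) : 0 < ∑ k, A k j :=
  Finset.sum_pos' (fun k _ => h.1 k j)
    ⟨τ.symm j, Finset.mem_univ _, by simpa using h.2 (τ.symm j)⟩

lemma GoodM.rowNorm {n : ℕ} {τ : Equiv.Perm (Fin n)} {A : Matrix (Fin n) (Fin n) ℝ}
    (h : GoodM τ A) : GoodM τ (rowNorm A) :=
  ⟨fun i j => div_nonneg (h.1 i j) (h.row_pos i).le, fun i => div_pos (h.2 i) (h.row_pos i)⟩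

lemma GoodM.colNorm {n : ℕ} {τ : Equiv.Perm (Fin n)} {A : Matrix (Fin n) (Fin n) ℝ}
    (h : GoodM τ A) : GoodM τ (colNorm A) :=
  ⟨fun i j => div_nonneg (h.1 i j) (h.col_pos j).le, fun i => div_pos (h.2 i) (h.col_pos _)⟩

lemma GoodM.skL {n : ℕ} {τ : Equiv.Perm (Fin n)} {A : Matrix (Fin n) (Fin n) ℝ}
    (h : GoodM τ A) (k : ℕ) : GoodM τ (skL A k) := by
  induction k with
  | zero => exact h.rowNorm
  | succ k ih => exact ih.colNorm.rowNorm

lemma GoodM.row_sum {n : ℕ} {τ : Equiv.Perm (Fin n)} {A : Matrix (Fin n) (Fin n) ℝ}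
    (h : GoodM τ A) (i : Fin n) : ∑ j, _root_.rowNorm A i j = 1 := by
  simp only [_root_.rowNorm, Matrix.of_apply]
  rw [← Finset.sum_div, div_self (h.row_pos i).ne']

lemma GoodM.col_sum {n : ℕ} {τ : Equiv.Perm (Fin n)} {A : Matrix (Fin n) (Fin n) ℝ}
    (h : GoodM τ A) (j : Fin n) : ∑ i, _root_.colNorm A i j = 1 := by
  simp only [_root_.colNorm, Matrix.of_apply]
  rw [← Finset.sum_div, div_self (h.col_pos j).ne']

lemma GoodM.skL_row {n : ℕ} {τ : Equiv.Perm (Fin n)} {A : Matrix (Fin n) (Fin n) ℝ}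
    (h : GoodM τ A) (k : ℕ) (i : Fin n) : ∑ j, _root_.skL A k i j = 1 := by
  cases k with
  | zero => exact h.row_sum i
  | succ k => exact (h.skL k).colNorm.row_sum i

lemma diagProd_rowNorm {n : ℕ} (A : Matrix (Fin n) (Fin n) ℝ) (σ : Equiv.Perm (Fin n)) :
    diagProd (rowNorm A) σ = diagProd A σ / ∏ i, ∑ k, A i k := by
  simp [diagProd, rowNorm, Finset.prod_div_distrib]

lemma diagProd_colNorm {n : ℕ} (A : Matrix (Fin n) (Fin n) ℝ) (σ : Equiv.Perm (Fin n)) :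
    diagProd (colNorm A) σ = diagProd A σ / ∏ j, ∑ k, A k j := by
  simp only [diagProd, colNorm, Finset.prod_div_distrib, Matrix.of_apply]
  rw [Equiv.prod_comp σ (fun j => ∑ k, A k j)]

lemma skL_cross {n : ℕ} (A : Matrix (Fin n) (Fin n) ℝ) (τ σ : Equiv.Perm (Fin n)) (k : ℕ) :
    diagProd (skL A k) σ * diagProd A τ = diagProd (skL A k) τ * diagProd A σ := by
  induction k with
  | zero => simp only [skL, diagProd_rowNorm]; ring
  | succ k ih =>
    simp only [skL, diagProd_rowNorm, diagProd_colNorm, div_mul_eq_mul_div, ih]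

lemma sum_colsums {n : ℕ} (A : Matrix (Fin n) (Fin n) ℝ) (h : ∀ i, ∑ j, A i j = 1) :
    ∑ j, ∑ i, A i j = n := by
  rw [Finset.sum_comm]; simp [h]

lemma sum_rowsums {n : ℕ} (A : Matrix (Fin n) (Fin n) ℝ) (h : ∀ j, ∑ i, A i j = 1) :
    ∑ i, ∑ j, A i j = n := by
  calc ∑ i, ∑ j, A i j = ∑ j, ∑ i, A i j := Finset.sum_comm
    _ = n := by simp [h]

/-- One step of the iteration increases diagonal products. -/
lemma skL_step {n : ℕ} {τ : Equiv.Perm (Fin n)} {A : Matrix (Fin n) (Fin n) ℝ}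
    (h : GoodM τ A) (k : ℕ) :
    diagProd (skL A k) τ ≤ diagProd (skL A (k + 1)) τ * ∏ j, ∑ i, skL A k i j := by
  have hk := h.skL k
  have hc := hk.colNorm
  have hP : 0 < ∏ j, ∑ i, skL A k i j := Finset.prod_pos fun j _ => hk.col_pos j
  have hR : 0 < ∏ i, ∑ j, colNorm (skL A k) i j := Finset.prod_pos fun j _ => hc.row_pos j
  have hR1 : ∏ i, ∑ j, colNorm (skL A k) i j ≤ 1 :=
    aux_prod_le_one _ (fun i => (hc.row_pos i).le) (sum_rowsums _ hk.col_sum)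
  have hg : 0 < diagProd (skL A k) τ := Finset.prod_pos fun i _ => hk.2 i
  have e : diagProd (skL A (k + 1)) τ * ∏ j, ∑ i, skL A k i j
      = diagProd (skL A k) τ / ∏ i, ∑ j, colNorm (skL A k) i j := by
    rw [show skL A (k + 1) = rowNorm (colNorm (skL A k)) from rfl, diagProd_rowNorm,
      diagProd_colNorm]
    field_simp
  rw [e, le_div_iff₀ hR]
  nlinarith

lemma skL_le_one {n : ℕ} {τ : Equiv.Perm (Fin n)} {A : Matrix (Fin n) (Fin n) ℝ}
    (h : GoodM τ A) (k : ℕ) (i j : Fin n) : skL A k i j ≤ 1 := by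
  rw [← h.skL_row k i]
  exact Finset.single_le_sum (f := fun j => skL A k i j) (fun j _ => (h.skL k).1 i j)
    (Finset.mem_univ j)

lemma diagProd_tendsto {n : ℕ} {ι : Type*} {F : Filter ι} {f : ι → Matrix (Fin n) (Fin n) ℝ}
    {L : Matrix (Fin n) (Fin n) ℝ} (h : ∀ i j, Tendsto (fun k => f k i j) F (nhds (L i j)))
    (σ : Equiv.Perm (Fin n)) :
    Tendsto (fun k => diagProd (f k) σ) F (nhds (diagProd L σ)) :=
  tendsto_finsetProd _ fun i _ => h i (σ i)

/-- Convergence of the Sinkhorn iteration. -/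
lemma sinkhorn_converges_s7 {n : ℕ} {τ : Equiv.Perm (Fin n)} {A : Matrix (Fin n) (Fin n) ℝ}
    (h : GoodM τ A) : ∃ (L : Matrix (Fin n) (Fin n) ℝ) (c : ℝ), DoublyStochastic L ∧
      EntrywiseLimit (skL A) L ∧ EntrywiseLimit (skT A) L ∧ 0 < c ∧
      ∀ σ, diagProd L σ = c * diagProd A σ := by
  have hgpos : ∀ k, 0 < diagProd (skL A k) τ := fun k =>
    Finset.prod_pos fun i _ => (h.skL k).2 i
  have hA : 0 < diagProd A τ := Finset.prod_pos fun i _ => h.2 i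
  have hmono : Monotone (fun k => diagProd (skL A k) τ) := by
    apply monotone_nat_of_le_succ
    intro k
    refine (skL_step h k).trans ?_
    have := aux_prod_le_one (fun j => ∑ i, skL A k i j) (fun j => ((h.skL k).col_pos j).le)
      (sum_colsums _ (h.skL_row k))
    exact mul_le_of_le_one_right (hgpos _).le this
  have hbdd : BddAbove (Set.range (fun k => diagProd (skL A k) τ)) := by
    refine ⟨1, ?_⟩
    rintro _ ⟨k, rfl⟩
    exact Finset.prod_le_one (fun i _ => (h.skL k).1 _ _) (fun i _ => skL_le_one h k _ _)
  obtain ⟨g, hg⟩ : ∃ g, Tendsto (fun k => diagProd (skL A k) τ) atTop (nhds g) :=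
    ⟨_, tendsto_atTop_ciSup hmono hbdd⟩
  have hg0 : 0 < g := lt_of_lt_of_le (hgpos 0) (hmono.ge_of_tendsto hg 0)
  have hclus : ∀ x : Matrix (Fin n) (Fin n) ℝ, MapClusterPt x atTop (skL A) →
      DoublyStochastic x ∧ ∀ σ, diagProd x σ = (g / diagProd A τ) * diagProd A σ := by
    intro x hx
    obtain ⟨U, hU, hUx⟩ := mapClusterPt_iff_ultrafilter.1 hx
    have hent : ∀ i j, Tendsto (fun k => skL A k i j) U (nhds (x i j)) := fun i j =>
      ((continuous_id.matrix_elem i j).tendsto x).comp hUx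
    have hx0 : ∀ i j, 0 ≤ x i j := fun i j =>
      ge_of_tendsto' (hent i j) (fun k => (h.skL k).1 i j)
    have hrow : ∀ i, ∑ j, x i j = 1 := by
      intro i
      have h1 : Tendsto (fun k => ∑ j, skL A k i j) U (nhds (∑ j, x i j)) :=
        tendsto_finsetSum _ fun j _ => hent i j
      simp only [h.skL_row] at h1
      exact tendsto_nhds_unique h1 tendsto_const_nhds
    have hgU := hg.mono_left hU
    have hgU' := ((tendsto_add_atTop_iff_nat 1).2 hg).mono_left hU
    have hprod : Tendsto (fun k => ∏ j, ∑ i, skL A k i j) U (nhds (∏ j, ∑ i, x i j)) :=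
      tendsto_finsetProd _ fun j _ => tendsto_finsetSum _ fun i _ => hent i j
    have hle : g ≤ g * ∏ j, ∑ i, x i j :=
      le_of_tendsto_of_tendsto' hgU (hgU'.mul hprod) (fun k => skL_step h k)
    have hge : 1 ≤ ∏ j, ∑ i, x i j := le_of_mul_le_mul_left (by linarith) hg0
    refine ⟨⟨hx0, hrow, aux_eq_one _ (fun j => Finset.sum_nonneg fun i _ => hx0 i j)
      (sum_colsums _ hrow) hge⟩, ?_⟩
    intro σ
    have h1 := (diagProd_tendsto hent σ).mul_const (diagProd A τ)
    have h2 := hgU.mul_const (diagProd A σ)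
    simp only [skL_cross A τ σ] at h1
    have h3 := tendsto_nhds_unique h1 h2
    field_simp
    linarith
  let K : Set (Matrix (Fin n) (Fin n) ℝ) :=
    Set.pi Set.univ fun _ => Set.pi Set.univ fun _ => Set.Icc (0:ℝ) 1
  have hK : IsCompact K := isCompact_univ_pi fun _ => isCompact_univ_pi fun _ => isCompact_Icc
  have hmem : ∀ k, skL A k ∈ K := fun k i _ j _ => ⟨(h.skL k).1 i j, skL_le_one h k i j⟩
  obtain ⟨L, -, hLc⟩ := hK.exists_mapClusterPt (f := atTop) (u := skL A)
    (by rw [le_principal_iff]; exact Filter.mem_map.2 (Filter.Eventually.of_forall hmem))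
  obtain ⟨hLd, hLp⟩ := hclus L hLc
  have hlim : Tendsto (skL A) atTop (nhds L) := by
    refine hK.tendsto_nhds_of_unique_mapClusterPt (Filter.Eventually.of_forall hmem) ?_
    intro x _ hx
    obtain ⟨hxd, hxp⟩ := hclus x hx
    exact ds_unique hLd hxd 1 one_pos (fun σ => by rw [hxp, hLp, one_mul])
  have hent : EntrywiseLimit (skL A) L := fun i j =>
    ((continuous_id.matrix_elem i j).tendsto L).comp hlim
  refine ⟨L, g / diagProd A τ, hLd, hent, ?_, div_pos hg0 hA, hLp⟩
  intro i j
  have h1 : Tendsto (fun k => ∑ i, skL A k i j) atTop (nhds (∑ i, L i j)) :=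
    tendsto_finsetSum _ fun i _ => hent i j
  have h2 := (hent i j).div h1 (by rw [hLd.2.2 j]; exact one_ne_zero)
  rw [hLd.2.2 j, div_one] at h2
  exact h2

/-- Perturbing an entry that is off-diagonal in both M and the perturbed
matrix M^ε does not change the Sinkhorn limit; in particular CI(M) = CI(M^ε). -/
theorem offDiag_perturbation_same_limit (n : ℕ) (M Mε : Matrix (Fin n) (Fin n) ℝ)
    (s t : Fin n) (ε : ℝ) (hε : 0 < ε)
    (hM : Admissible M) (hpd : HasPosDiag M)
    (hMε : ∀ i j, Mε i j = if i = s ∧ j = t then M s t + ε else M i j)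
    (hoffM : ¬ OnDiag M s t) (hoffMε : ¬ OnDiag Mε s t) :
    ∃ Mstar : Matrix (Fin n) (Fin n) ℝ, DoublyStochastic Mstar ∧
      EntrywiseLimit (skL M) Mstar ∧ EntrywiseLimit (skT M) Mstar ∧
      EntrywiseLimit (skL Mε) Mstar ∧ EntrywiseLimit (skT Mε) Mstar := by
  obtain ⟨τ, hτ⟩ := hpd
  have hG : GoodM τ M := ⟨hM.1, hτ⟩
  have hle : ∀ i j, M i j ≤ Mε i j := by
    intro i j
    rw [hMε]
    split_ifs with hij
    · rw [hij.1, hij.2]; linarith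
    · exact le_rfl
  have hG' : GoodM τ Mε :=
    ⟨fun i j => (hM.1 i j).trans (hle i j), fun i => (hτ i).trans_le (hle _ _)⟩
  have hzero : ∀ (B : Matrix (Fin n) (Fin n) ℝ), GoodM τ B → ¬ OnDiag B s t →
      ∀ σ : Equiv.Perm (Fin n), σ s = t → diagProd B σ = 0 := by
    intro B hB hoff σ hσ
    by_contra hne
    have hpos : 0 < diagProd B σ :=
      lt_of_le_of_ne (Finset.prod_nonneg fun i _ => hB.1 _ _) (Ne.symm hne)
    exact hoff ⟨σ, fun k => diagProd_pos_entry hB.1 hpos k, hσ⟩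
  have hdiag : ∀ σ, diagProd Mε σ = diagProd M σ := by
    intro σ
    by_cases hσ : σ s = t
    · rw [hzero M hG hoffM σ hσ, hzero Mε hG' hoffMε σ hσ]
    · refine Finset.prod_congr rfl fun i _ => ?_
      rw [hMε, if_neg]
      rintro ⟨rfl, h2⟩
      exact hσ h2
  obtain ⟨L, c, hL, h1, h2, hc, hLp⟩ := sinkhorn_converges_s7 hG
  obtain ⟨L', c', hL', h1', h2', hc', hLp'⟩ := sinkhorn_converges_s7 hG'
  have hEq : L' = L := by
    refine ds_unique hL hL' (c' / c) (div_pos hc' hc) fun σ => ?_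
    rw [hLp', hLp, hdiag]
    field_simp
  rw [hEq] at h1' h2'
  exact ⟨L, hL, h1, h2, h1', h2'⟩
end

section
/- Let A and B be nonnegative u×v matrices having the same row sums (∑_j a_{ij} = ∑_j b_{ij} for all i) and the same column sums (∑_i a_{ij} = ∑_i b_{ij} for all j). If there exist diagonal matrices X (u×u) and Y (v×v) with positive diagonal entries such that A = X B Y, then A = B. -/
open Matrix Filter

/-- Two nonnegative matrices with the same row sums and the same column
sums which are diagonally equivalent (A = X B Y with X, Y diagonal with positive
diagonal entries) are equal. -/
theorem diagonally_equivalent_same_margins_eq (u v : ℕ) (A B : Matrix (Fin u) (Fin v) ℝ)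
    (hA : ∀ i j, 0 ≤ A i j) (hB : ∀ i j, 0 ≤ B i j)
    (hrow : ∀ i, ∑ j, A i j = ∑ j, B i j)
    (hcol : ∀ j, ∑ i, A i j = ∑ i, B i j)
    (x : Fin u → ℝ) (y : Fin v → ℝ) (hx : ∀ i, 0 < x i) (hy : ∀ j, 0 < y j)
    (hXY : A = Matrix.diagonal x * B * Matrix.diagonal y) :
    A = B := by
  have hE : ∀ i j, A i j = x i * B i j * y j := by
    intro i j
    rw [hXY, Matrix.mul_diagonal, Matrix.diagonal_mul]
  have hnn : ∀ i j, 0 ≤ (A i j - B i j) * (Real.log (x i) + Real.log (y j)) := by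
    intro i j
    rw [hE, ← Real.log_mul (hx i).ne' (hy j).ne']
    have ht : 0 < x i * y j := mul_pos (hx i) (hy j)
    have h : x i * B i j * y j - B i j = B i j * (x i * y j - 1) := by ring
    rw [h, mul_assoc]
    refine mul_nonneg (hB i j) ?_
    rcases le_total 1 (x i * y j) with h1 | h1
    · exact mul_nonneg (by linarith) (Real.log_nonneg h1)
    · exact mul_nonneg_of_nonpos_of_nonpos (by linarith) (Real.log_nonpos ht.le h1)
  have hsum : ∑ i, ∑ j, (A i j - B i j) * (Real.log (x i) + Real.log (y j)) = 0 := by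
    have h1 : ∑ i, ∑ j, (A i j - B i j) * Real.log (x i) = 0 := by
      refine Finset.sum_eq_zero fun i _ => ?_
      rw [← Finset.sum_mul, Finset.sum_sub_distrib, hrow i, sub_self, zero_mul]
    have h2 : ∑ i, ∑ j, (A i j - B i j) * Real.log (y j) = 0 := by
      rw [Finset.sum_comm]
      refine Finset.sum_eq_zero fun j _ => ?_
      rw [← Finset.sum_mul, Finset.sum_sub_distrib, hcol j, sub_self, zero_mul]
    simp only [mul_add, Finset.sum_add_distrib]
    rw [h1, h2, add_zero]
  ext i j
  have hi := (Finset.sum_eq_zero_iff_of_nonneg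
    (fun i _ => Finset.sum_nonneg fun j _ => hnn i j)).1 hsum i (Finset.mem_univ i)
  have hij := (Finset.sum_eq_zero_iff_of_nonneg (fun j _ => hnn i j)).1 hi j (Finset.mem_univ j)
  rcases mul_eq_zero.1 hij with h | h
  · exact sub_eq_zero.1 h
  · rw [← Real.log_mul (hx i).ne' (hy j).ne'] at h
    have h1 : x i * y j = 1 :=
      Real.eq_one_of_pos_of_log_eq_zero (mul_pos (hx i) (hy j)) h
    rw [hE]
    linear_combination B i j * h1
end

section
/- For any admissible u×v matrix M there exists a 0–1 matrix A with A ≺ M such that, after suitable permutations of its rows and columns, A is block-diagonal of the form diag(B_1, …, B_k), where each block B_i is either an all-ones row vector (1,…,1) or an all-ones column vector (1,…,1)ᵀ. -/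
open Matrix Filter

/-- For any admissible matrix M there is a 0–1 matrix A ≺ M which is,
up to row and column permutations, block diagonal with each block an all-ones row
vector or an all-ones column vector. This is formalized via block-assignment maps
`rb`, `cb` onto `Fin k`: A vanishes outside the blocks, every entry inside a block is 1,
and each block has either exactly one row or exactly one column. -/
theorem exists_binary_block_diagonal_subpattern (u v : ℕ) (M : Matrix (Fin u) (Fin v) ℝ)
    (hM : Admissible M) :
    ∃ (A : Matrix (Fin u) (Fin v) ℝ) (k : ℕ) (rb : Fin u → Fin k) (cb : Fin v → Fin k),
      PartialPattern A M ∧ (∀ i j, A i j = 0 ∨ A i j = 1) ∧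
      Function.Surjective rb ∧ Function.Surjective cb ∧
      (∀ i j, A i j ≠ 0 → rb i = cb j) ∧
      (∀ b : Fin k,
        (Nat.card {i : Fin u // rb i = b} = 1 ∨ Nat.card {j : Fin v // cb j = b} = 1) ∧
        ∀ i j, rb i = b → cb j = b → A i j = 1) := by
  classical
  obtain ⟨-, hr, hc⟩ := hM
  let P : Set (Fin u × Fin v) → Prop := fun E =>
    (∀ p ∈ E, M p.1 p.2 ≠ 0) ∧ (∀ i, ∃ j, (i, j) ∈ E) ∧ (∀ j, ∃ i, (i, j) ∈ E)
  have hP : P {p | M p.1 p.2 ≠ 0} := ⟨fun p hp => hp, hr, hc⟩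
  obtain ⟨E, hE⟩ := exists_minimal_of_wellFoundedLT P ⟨_, hP⟩
  obtain ⟨hsub, hrow, hcol⟩ := hE.prop
  have key : ∀ i j, (i, j) ∈ E → (∀ j', (i, j') ∈ E → j' = j) ∨ (∀ i', (i', j) ∈ E → i' = i) := by
    intro i j hij
    by_contra! hcon
    obtain ⟨⟨j', hj', hjn⟩, ⟨i', hi', hin⟩⟩ := hcon
    have hQ : P (E \ {(i, j)}) := by
      refine ⟨fun p hp => hsub p hp.1, fun a => ?_, fun b => ?_⟩
      · by_cases ha : a = i
        · subst ha
          exact ⟨j', hj', by simp [hjn]⟩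
        · obtain ⟨b, hb⟩ := hrow a
          exact ⟨b, hb, by simp [ha]⟩
      · by_cases hb : b = j
        · subst hb
          exact ⟨i', hi', by simp [hin]⟩
        · obtain ⟨a, ha⟩ := hcol b
          exact ⟨a, ha, by simp [hb]⟩
    have := hE.le_of_le hQ Set.diff_subset hij
    simp at this
  have path : ∀ i j i' j', (i, j) ∈ E → (i', j) ∈ E → (i', j') ∈ E → (i, j') ∈ E := by
    intro i j i' j' h1 h2 h3
    rcases key i' j h2 with h | h
    · rw [h j' h3]; exact h1
    · rw [h i h1]; exact h3
  let S : Setoid (Fin u) :=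
    { r := fun i i' => ∃ j, (i, j) ∈ E ∧ (i', j) ∈ E
      iseqv :=
        { refl := fun i => (hrow i).imp fun j hj => ⟨hj, hj⟩
          symm := fun ⟨j, h1, h2⟩ => ⟨j, h2, h1⟩
          trans := fun ⟨j, h1, h2⟩ ⟨j', h3, h4⟩ => ⟨j', path _ _ _ _ h1 h2 h3, h4⟩ } }
  choose g hg using hcol
  let e := Finite.equivFin (Quotient S)
  let rb : Fin u → Fin (Nat.card (Quotient S)) := fun i => e (Quotient.mk S i)
  let cb : Fin v → Fin (Nat.card (Quotient S)) := fun j => rb (g j)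
  have hiff : ∀ i j, rb i = cb j ↔ (i, j) ∈ E := by
    intro i j
    constructor
    · intro h
      obtain ⟨j', h1, h2⟩ := Quotient.exact (e.injective h)
      exact path _ _ _ _ h1 h2 (hg j)
    · intro h
      exact congrArg e (Quotient.sound (s := S) ⟨j, h, hg j⟩)
  have hrb : Function.Surjective rb := e.surjective.comp Quotient.mk_surjective
  refine ⟨fun i j => if (i, j) ∈ E then 1 else 0, _, rb, cb, ?_, ?_, hrb, ?_, ?_, ?_⟩
  · intro i j h
    exact if_neg fun hm => hsub _ hm h
  · intro i j
    by_cases h : (i, j) ∈ E <;> simp [h]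
  · intro b
    obtain ⟨i, rfl⟩ := hrb b
    obtain ⟨j, hj⟩ := hrow i
    exact ⟨j, ((hiff i j).2 hj).symm⟩
  · intro i j h
    by_contra hn
    exact h (if_neg fun hm => hn ((hiff i j).2 hm))
  · intro b
    refine ⟨?_, fun i j hi hj => if_pos ((hiff i j).1 (hi.trans hj.symm))⟩
    obtain ⟨i, rfl⟩ := hrb b
    obtain ⟨j, hj⟩ := hrow i
    have hij := (hiff i j).2 hj
    rcases key i j hj with h | h
    · right
      rw [Nat.card_eq_one_iff_exists]
      exact ⟨⟨j, hij.symm⟩, fun ⟨j', h'⟩ => Subtype.ext (h j' ((hiff i j').1 h'.symm))⟩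
    · left
      rw [Nat.card_eq_one_iff_exists]
      exact ⟨⟨i, rfl⟩, fun ⟨i', h'⟩ => Subtype.ext (h i' ((hiff i' j).1 (h'.trans hij)))⟩
end

section
/- Distinct doubly stochastic matrices do not have proportional diagonal products: if A and B are n×n doubly stochastic matrices and there exists a constant k > 0 such that ∏_i a_{iσ(i)} = k · ∏_i b_{iσ(i)} for every permutation σ of {1,…,n}, then A = B. -/
open Matrix Filter

/-- Birkhoff decomposition in the coordinates we need. -/
lemma ds_birkhoff {n : ℕ} (A : Matrix (Fin n) (Fin n) ℝ) (hA : DoublyStochastic A) :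
    ∃ w : Equiv.Perm (Fin n) → ℝ, (∀ σ, 0 ≤ w σ) ∧ ∑ σ, w σ = 1 ∧
      ∀ i j, A i j = ∑ σ, w σ * (if σ i = j then 1 else 0) := by
  have hm : A ∈ doublyStochastic ℝ (Fin n) := by
    rw [mem_doublyStochastic_iff_sum]
    exact hA
  obtain ⟨w, h0, h1, h2⟩ := exists_eq_sum_perm_of_mem_doublyStochastic hm
  refine ⟨w, h0, h1, fun i j => ?_⟩
  rw [← h2, Matrix.sum_apply]
  refine Finset.sum_congr rfl fun σ _ => ?_
  simp [Equiv.Perm.permMatrix, PEquiv.toMatrix_apply, Equiv.toPEquiv_apply, eq_comm]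

lemma ds_weight_pos {n : ℕ} {A : Matrix (Fin n) (Fin n) ℝ}
    {w : Equiv.Perm (Fin n) → ℝ} (h0 : ∀ σ, 0 ≤ w σ)
    (h2 : ∀ i j, A i j = ∑ σ, w σ * (if σ i = j then 1 else 0))
    (σ : Equiv.Perm (Fin n)) (hσ : 0 < w σ) (i : Fin n) : 0 < A i (σ i) := by
  rw [h2]
  refine Finset.sum_pos' (fun τ _ => mul_nonneg (h0 τ) (by split_ifs <;> norm_num))
    ⟨σ, Finset.mem_univ _, by simpa using hσ⟩

lemma ds_totalSupport {n : ℕ} (A : Matrix (Fin n) (Fin n) ℝ) (hA : DoublyStochastic A) :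
    TotalSupport A := by
  intro i j hij
  obtain ⟨w, h0, h1, h2⟩ := ds_birkhoff A hA
  have h3 := hij
  rw [h2] at h3
  obtain ⟨σ, -, hσ⟩ := Finset.exists_ne_zero_of_sum_ne_zero h3.ne'
  have hj : σ i = j := by
    by_contra hne
    simp [hne] at hσ
  refine ⟨σ, fun l => ds_weight_pos h0 h2 σ ?_ l, hj⟩
  exact lt_of_le_of_ne (h0 σ) (fun h => hσ (by simp [← h]))

lemma ds_sum_eq {n : ℕ} (A L : Matrix (Fin n) (Fin n) ℝ) (hA : DoublyStochastic A) (c : ℝ)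
    (hL : ∀ σ : Equiv.Perm (Fin n), (∀ i, 0 < A i (σ i)) → ∑ i, L i (σ i) = c) :
    ∑ i, ∑ j, A i j * L i j = c := by
  obtain ⟨w, h0, h1, h2⟩ := ds_birkhoff A hA
  have e : ∑ i, ∑ j, A i j * L i j = ∑ σ, w σ * ∑ i, L i (σ i) := by
    have e1 : ∀ i, ∑ j, A i j * L i j = ∑ σ, w σ * L i (σ i) := by
      intro i
      simp_rw [h2, Finset.sum_mul]
      rw [Finset.sum_comm]
      refine Finset.sum_congr rfl fun σ _ => ?_
      simp
    simp_rw [e1, Finset.mul_sum]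
    rw [Finset.sum_comm]
  rw [e]
  have e3 : ∀ σ ∈ Finset.univ, w σ * ∑ i, L i (σ i) = w σ * c := by
    intro σ _
    rcases (h0 σ).eq_or_lt with h | h
    · simp [← h]
    · rw [hL σ (ds_weight_pos h0 h2 σ h)]
  rw [Finset.sum_congr rfl e3, ← Finset.sum_mul, h1, one_mul]

lemma log_term {a b : ℝ} (ha : 0 < a) (hb : 0 < b) (hne : a ≠ b) :
    0 < (a - b) * (Real.log a - Real.log b) := by
  rcases lt_or_gt_of_ne hne with h | h
  · have := Real.log_lt_log ha h
    exact mul_pos_of_neg_of_neg (by linarith) (by linarith)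
  · have := Real.log_lt_log hb h
    exact mul_pos (by linarith) (by linarith)

/-- Distinct doubly stochastic matrices do not have proportional diagonal
products: if all corresponding diagonal products of A and B are proportional with ratio
k > 0, then A = B. -/
theorem doublyStochastic_proportional_diagProds_eq (n : ℕ)
    (A B : Matrix (Fin n) (Fin n) ℝ)
    (hA : DoublyStochastic A) (hB : DoublyStochastic B)
    (k : ℝ) (hk : 0 < k)
    (h : ∀ σ : Equiv.Perm (Fin n), ∏ i, A i (σ i) = k * ∏ i, B i (σ i)) :
    A = B := by
  have key : ∀ σ : Equiv.Perm (Fin n), (∀ i, 0 < A i (σ i)) ↔ (∀ i, 0 < B i (σ i)) := by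
    intro σ
    have pos_iff : ∀ M : Matrix (Fin n) (Fin n) ℝ, DoublyStochastic M →
        ((∀ i, 0 < M i (σ i)) ↔ ∏ i, M i (σ i) ≠ 0) := by
      intro M hM
      rw [Finset.prod_ne_zero_iff]
      exact ⟨fun H i _ => (H i).ne', fun H i =>
        lt_of_le_of_ne (hM.1 _ _) (H i (Finset.mem_univ _)).symm⟩
    rw [pos_iff A hA, pos_iff B hB, h σ]
    simp [hk.ne']
  have supp : ∀ i j, 0 < A i j ↔ 0 < B i j := by
    intro i j
    constructor
    · intro hij
      obtain ⟨σ, h1, rfl⟩ := ds_totalSupport A hA i j hij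
      exact (key σ).1 h1 i
    · intro hij
      obtain ⟨σ, h1, rfl⟩ := ds_totalSupport B hB i j hij
      exact (key σ).2 h1 i
  let L : Matrix (Fin n) (Fin n) ℝ := fun i j => Real.log (A i j) - Real.log (B i j)
  have hL : ∀ σ : Equiv.Perm (Fin n), (∀ i, 0 < A i (σ i)) → ∑ i, L i (σ i) = Real.log k := by
    intro σ h1
    have h2 := (key σ).1 h1
    have h3 := congrArg Real.log (h σ)
    rw [Real.log_mul hk.ne' (Finset.prod_pos fun i _ => h2 i).ne',
      Real.log_prod (fun i _ => (h1 i).ne'), Real.log_prod (fun i _ => (h2 i).ne')] at h3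
    simp only [L, Finset.sum_sub_distrib]
    linarith
  have sA := ds_sum_eq A L hA _ hL
  have sB := ds_sum_eq B L hB _ (fun σ h2 => hL σ ((key σ).2 h2))
  have s0 : ∑ i, ∑ j, (A i j - B i j) * L i j = 0 := by
    simp_rw [sub_mul, Finset.sum_sub_distrib]
    linarith
  have term : ∀ i j, A i j ≠ B i j → 0 < (A i j - B i j) * L i j := by
    intro i j hne
    have ha : 0 < A i j := by
      by_contra hn
      have hb := fun hb => hn ((supp i j).2 hb)
      exact hne (by linarith [hA.1 i j, hB.1 i j, not_lt.1 hb, not_lt.1 hn])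
    exact log_term ha ((supp i j).1 ha) hne
  have nn : ∀ i j, 0 ≤ (A i j - B i j) * L i j := by
    intro i j
    by_cases he : A i j = B i j
    · simp [he]
    · exact (term i j he).le
  ext i j
  by_contra hne
  have r := (Finset.sum_eq_zero_iff_of_nonneg
    (fun i _ => Finset.sum_nonneg fun j _ => nn i j)).1 s0 i (Finset.mem_univ _)
  have r2 := (Finset.sum_eq_zero_iff_of_nonneg (fun j _ => nn i j)).1 r j (Finset.mem_univ _)
  exact (term i j hne).ne' r2
end

section
/- Let M be an admissible n×n matrix with total support. Then the Sinkhorn iteration of M converges to a doubly stochastic matrix M*, and there exist diagonal matrices X and Y with positive diagonal entries such that M = X M* Y. -/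
open Matrix Filter

open Topology

lemma prod_aux {n : ℕ} (c : Fin n → ℝ) (hc : ∀ j, 0 < c j) (hs : ∑ j, c j = n) :
    ∏ j, c j ≤ 1 ∧ (1 ≤ ∏ j, c j → ∀ j, c j = 1) := by
  have h1 : ∏ j, Real.exp (c j - 1) = 1 := by
    rw [← Real.exp_sum]
    simp [hs]
  have h2 : ∀ j, c j ≤ Real.exp (c j - 1) := fun j => by
    have := Real.add_one_le_exp (c j - 1)
    linarith
  constructor
  · rw [← h1]
    exact Finset.prod_le_prod (fun j _ => (hc j).le) (fun j _ => h2 j)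
  · intro h j
    by_contra hj
    have : ∏ j, c j < ∏ j, Real.exp (c j - 1) := by
      apply Finset.prod_lt_prod (fun j _ => hc j) (fun j _ => h2 j)
      refine ⟨j, Finset.mem_univ _, ?_⟩
      have := Real.add_one_lt_exp (sub_ne_zero.2 hj)
      linarith
    linarith

/-- Diagonal equivalence, in exponential coordinates. -/
def DE {n : ℕ} (M A : Matrix (Fin n) (Fin n) ℝ) : Prop :=
  ∃ u v : Fin n → ℝ, ∀ i j, A i j = Real.exp (u i) * M i j * Real.exp (v j)

section
variable {n : ℕ} {M A : Matrix (Fin n) (Fin n) ℝ}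

lemma DE.nonneg (h : DE M A) (hM : Admissible M) (i j) : 0 ≤ A i j := by
  obtain ⟨u, v, h⟩ := h
  rw [h]
  have := hM.1 i j
  positivity

lemma DE.zero (h : DE M A) (i j) (h0 : M i j = 0) : A i j = 0 := by
  obtain ⟨u, v, h⟩ := h
  rw [h, h0]; simp

lemma DE.pos (h : DE M A) (i j) (h0 : 0 < M i j) : 0 < A i j := by
  obtain ⟨u, v, h⟩ := h
  rw [h]; positivity

lemma DE.row_pos (h : DE M A) (hM : Admissible M) (i) : 0 < ∑ j, A i j := by
  obtain ⟨j, hj⟩ := hM.2.1 i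
  exact Finset.sum_pos' (fun j _ => h.nonneg hM i j)
    ⟨j, Finset.mem_univ _, h.pos i j (lt_of_le_of_ne (hM.1 i j) hj.symm)⟩

lemma DE.col_pos (h : DE M A) (hM : Admissible M) (j) : 0 < ∑ i, A i j := by
  obtain ⟨i, hi⟩ := hM.2.2 j
  exact Finset.sum_pos' (fun i _ => h.nonneg hM i j)
    ⟨i, Finset.mem_univ _, h.pos i j (lt_of_le_of_ne (hM.1 i j) hi.symm)⟩

lemma DE.rowNorm (h : DE M A) (hM : Admissible M) : DE M (rowNorm A) := by
  have hp := h.row_pos hM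
  obtain ⟨u, v, h⟩ := h
  refine ⟨fun i => u i - Real.log (∑ j, A i j), v, fun i j => ?_⟩
  rw [Real.exp_sub, Real.exp_log (hp i)]
  simp only [_root_.rowNorm, Matrix.of_apply]
  rw [h i j]
  ring

lemma DE.colNorm (h : DE M A) (hM : Admissible M) : DE M (colNorm A) := by
  have hp := h.col_pos hM
  obtain ⟨u, v, h⟩ := h
  refine ⟨u, fun j => v j - Real.log (∑ i, A i j), fun i j => ?_⟩
  rw [Real.exp_sub, Real.exp_log (hp j)]
  simp only [_root_.colNorm, Matrix.of_apply]
  rw [h i j]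
  ring

lemma DE.rowNorm_sum (h : DE M A) (hM : Admissible M) (i) : ∑ j, _root_.rowNorm A i j = 1 := by
  simp only [_root_.rowNorm, Matrix.of_apply]
  rw [← Finset.sum_div, div_self (h.row_pos hM i).ne']

lemma DE.colNorm_sum (h : DE M A) (hM : Admissible M) (j) : ∑ i, _root_.colNorm A i j = 1 := by
  simp only [_root_.colNorm, Matrix.of_apply]
  rw [← Finset.sum_div, div_self (h.col_pos hM j).ne']

lemma DE.diag_nonneg (h : DE M A) (hM : Admissible M) (σ) : 0 ≤ diagProd A σ :=
  Finset.prod_nonneg fun i _ => h.nonneg hM _ _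

lemma diag_colNorm (σ) : diagProd (colNorm A) σ = diagProd A σ / ∏ j, ∑ i, A i j := by
  simp only [diagProd, _root_.colNorm, Matrix.of_apply, Finset.prod_div_distrib]
  rw [Equiv.prod_comp σ (fun j => ∑ i, A i j)]

lemma diag_rowNorm (σ) : diagProd (rowNorm A) σ = diagProd A σ / ∏ i, ∑ j, A i j := by
  simp only [diagProd, _root_.rowNorm, Matrix.of_apply, Finset.prod_div_distrib]

lemma DE.le_colNorm (h : DE M A) (hM : Admissible M) (hr : ∀ i, ∑ j, A i j = 1) (σ) :
    diagProd A σ ≤ diagProd (_root_.colNorm A) σ := by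
  rw [diag_colNorm]
  refine le_div_self (h.diag_nonneg hM σ) (Finset.prod_pos fun j _ => h.col_pos hM j)
    (prod_aux _ (h.col_pos hM) ?_).1
  rw [Finset.sum_comm]; simp [hr]

lemma DE.le_rowNorm (h : DE M A) (hM : Admissible M) (hr : ∀ j, ∑ i, A i j = 1) (σ) :
    diagProd A σ ≤ diagProd (_root_.rowNorm A) σ := by
  have hs : ∑ i, ∑ j, A i j = (n : ℝ) := by
    refine (Finset.sum_comm (f := fun i j => A i j)).trans ?_
    simp [hr]
  rw [diag_rowNorm]
  refine le_div_self (h.diag_nonneg hM σ) (Finset.prod_pos fun j _ => h.row_pos hM j)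
    (prod_aux (fun i => ∑ j, A i j) (h.row_pos hM) hs).1

lemma DE.skL (hM : Admissible M) (k) : DE M (skL M k) := by
  have h0 : DE M M := ⟨0, 0, by simp⟩
  induction k with
  | zero => exact h0.rowNorm hM
  | succ k ih => exact (ih.colNorm hM).rowNorm hM

lemma skL_row (hM : Admissible M) (k i) : ∑ j, skL M k i j = 1 := by
  have h0 : DE M M := ⟨0, 0, by simp⟩
  cases k with
  | zero => exact h0.rowNorm_sum hM i
  | succ k => exact ((DE.skL hM k).colNorm hM).rowNorm_sum hM i

lemma skL_le_skT (hM : Admissible M) (k σ) : diagProd (skL M k) σ ≤ diagProd (skT M k) σ :=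
  (DE.skL hM k).le_colNorm hM (skL_row hM k) σ

lemma skT_le_skL (hM : Admissible M) (k σ) :
    diagProd (skT M k) σ ≤ diagProd (skL M (k+1)) σ :=
  ((DE.skL hM k).colNorm hM).le_rowNorm hM ((DE.skL hM k).colNorm_sum hM) σ

lemma skL_mono (hM : Admissible M) (σ) : Monotone fun k => diagProd (skL M k) σ :=
  monotone_nat_of_le_succ fun k => (skL_le_skT hM k σ).trans (skT_le_skL hM k σ)

lemma skL_le_one_s19 (hM : Admissible M) (k i j) : skL M k i j ≤ 1 := by
  rw [← skL_row hM k i]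
  exact Finset.single_le_sum (fun j _ => (DE.skL hM k).nonneg hM i j) (Finset.mem_univ j)

lemma skL_diag_le_one (hM : Admissible M) (k σ) : diagProd (skL M k) σ ≤ 1 :=
  Finset.prod_le_one (fun _ _ => (DE.skL hM k).nonneg hM _ _) (fun _ _ => skL_le_one_s19 hM k _ _)

lemma skL_lower (hM : Admissible M) (hts : TotalSupport M) (i j) :
    ∃ δ : ℝ, 0 < δ ∧ ∀ k, 0 < M i j → δ ≤ skL M k i j := by
  by_cases h : 0 < M i j
  · obtain ⟨σ, hσ, hij⟩ := hts i j h
    refine ⟨diagProd (skL M 0) σ, Finset.prod_pos fun i _ => (DE.skL hM 0).pos _ _ (hσ i),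
      fun k _ => (skL_mono hM σ (Nat.zero_le k)).trans ?_⟩
    have hn := (DE.skL hM k).nonneg hM
    simp only [diagProd]
    rw [← Finset.mul_prod_erase _ _ (Finset.mem_univ i), hij]
    exact mul_le_of_le_one_right (hn _ _)
      (Finset.prod_le_one (fun _ _ => hn _ _) (fun _ _ => skL_le_one_s19 hM k _ _))
  · exact ⟨1, one_pos, fun k h' => absurd h' h⟩

/-- The linear map parametrizing log-scalings on the support. -/
noncomputable def scaleMap (M : Matrix (Fin n) (Fin n) ℝ) :
    ((Fin n → ℝ) × (Fin n → ℝ)) →ₗ[ℝ] (Fin n → Fin n → ℝ) where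
  toFun p := fun i j => if M i j = 0 then 0 else p.1 i + p.2 j
  map_add' p q := by
    ext i j
    by_cases h : M i j = 0 <;> simp [h]
    ring
  map_smul' c p := by
    ext i j
    by_cases h : M i j = 0 <;> simp [h]
    ring

lemma DE.limit (hM : Admissible M) {f : ℕ → Matrix (Fin n) (Fin n) ℝ} (hf : ∀ k, DE M (f k))
    {L : Matrix (Fin n) (Fin n) ℝ} (hL : EntrywiseLimit f L) (hpos : ∀ i j, 0 < M i j → 0 < L i j) :
    DE M L := by
  have hMp : ∀ i j, M i j ≠ 0 → 0 < M i j := fun i j h => lt_of_le_of_ne (hM.1 i j) h.symm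
  let G : Matrix (Fin n) (Fin n) ℝ → (Fin n → Fin n → ℝ) :=
    fun A i j => if M i j = 0 then 0 else Real.log (A i j / M i j)
  have hcl : IsClosed ((LinearMap.range (scaleMap M) : Submodule ℝ _) : Set (Fin n → Fin n → ℝ)) :=
    Submodule.closed_of_finiteDimensional _
  have ht : Tendsto (fun k => G (f k)) atTop (𝓝 (G L)) := by
    rw [tendsto_pi_nhds]; intro i
    rw [tendsto_pi_nhds]; intro j
    simp only [G]
    by_cases h : M i j = 0
    · simp [h]
    · simp only [h, if_false]
      have h1 := hMp i j h
      have h2 := hpos i j h1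
      exact ((hL i j).div_const _).log (by positivity)
  have hmem : G L ∈ ((LinearMap.range (scaleMap M) : Submodule ℝ _) : Set (Fin n → Fin n → ℝ)) := by
    refine hcl.mem_of_tendsto ht (Eventually.of_forall fun k => ?_)
    obtain ⟨u, v, h⟩ := hf k
    refine ⟨(u, v), ?_⟩
    ext i j
    simp only [scaleMap, G, LinearMap.coe_mk, AddHom.coe_mk]
    by_cases h0 : M i j = 0
    · simp [h0]
    · simp only [h0, if_false]
      rw [h i j, show Real.exp (u i) * M i j * Real.exp (v j) / M i j = Real.exp (u i + v j) by
        rw [Real.exp_add]; field_simp, Real.log_exp]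
  obtain ⟨⟨u, v⟩, h⟩ := hmem
  refine ⟨u, v, fun i j => ?_⟩
  by_cases h0 : M i j = 0
  · have : Tendsto (fun k => f k i j) atTop (𝓝 0) := by
      simp only [(hf _).zero i j h0]; exact tendsto_const_nhds
    rw [tendsto_nhds_unique (hL i j) this, h0]; simp
  · have h1 := hMp i j h0
    have h2 := hpos i j h1
    have h3 := congrFun (congrFun h i) j
    simp only [scaleMap, G, LinearMap.coe_mk, AddHom.coe_mk, h0, if_false] at h3
    have h4 : Real.exp (u i + v j) = L i j / M i j := by
      rw [h3, Real.exp_log (by positivity)]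
    rw [Real.exp_add] at h4
    rw [mul_right_comm, h4]
    field_simp

lemma term_nonneg (s : ℝ) : 0 ≤ (Real.exp s - 1) * s := by
  rcases le_total 0 s with h | h
  · have := Real.one_le_exp h
    exact mul_nonneg (by linarith) h
  · have := Real.exp_le_one_iff.2 h
    exact mul_nonneg_of_nonpos_of_nonpos (by linarith) h

lemma DE.unique {L L' : Matrix (Fin n) (Fin n) ℝ} (h : DE M L) (h' : DE M L')
    (hd : DoublyStochastic L) (hd' : DoublyStochastic L') : L' = L := by
  obtain ⟨u, v, h⟩ := h
  obtain ⟨u', v', h'⟩ := h'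
  let x : Fin n → ℝ := fun i => u' i - u i
  let y : Fin n → ℝ := fun j => v' j - v j
  have hxy : ∀ i j, L' i j = L i j * Real.exp (x i + y j) := by
    intro i j
    rw [h, h']
    simp only [x, y, Real.exp_add, Real.exp_sub]
    field_simp
  have hsum : ∑ i, ∑ j, (L' i j - L i j) * (x i + y j) = 0 := by
    simp only [mul_add, Finset.sum_add_distrib]
    rw [Finset.sum_comm (f := fun i j => (L' i j - L i j) * y j)]
    simp only [← Finset.sum_mul, Finset.sum_sub_distrib, hd.2.1, hd'.2.1, hd.2.2, hd'.2.2]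
    simp
  have hn : ∀ i j, 0 ≤ (L' i j - L i j) * (x i + y j) := by
    intro i j
    rw [hxy, show (L i j * Real.exp (x i + y j) - L i j) * (x i + y j)
      = L i j * ((Real.exp (x i + y j) - 1) * (x i + y j)) by ring]
    exact mul_nonneg (hd.1 i j) (term_nonneg _)
  ext i j
  rw [Finset.sum_eq_zero_iff_of_nonneg (fun i _ => Finset.sum_nonneg fun j _ => hn i j)] at hsum
  have h1 := hsum i (Finset.mem_univ _)
  rw [Finset.sum_eq_zero_iff_of_nonneg (fun j _ => hn i j)] at h1
  have h2 := h1 j (Finset.mem_univ _)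
  rcases mul_eq_zero.1 h2 with h3 | h3
  · linarith
  · rw [hxy, h3]; simp

lemma colNorm_limit {f : ℕ → Matrix (Fin n) (Fin n) ℝ} {L : Matrix (Fin n) (Fin n) ℝ}
    (hL : EntrywiseLimit f L) (hc : ∀ j, 0 < ∑ i, L i j) :
    EntrywiseLimit (fun k => colNorm (f k)) (colNorm L) := by
  intro i j
  simp only [_root_.colNorm, Matrix.of_apply]
  exact (hL i j).div (tendsto_finsetSum _ fun i _ => hL i j) (hc j).ne'

lemma diag_limit {f : ℕ → Matrix (Fin n) (Fin n) ℝ} {L : Matrix (Fin n) (Fin n) ℝ}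
    (hL : EntrywiseLimit f L) (σ) :
    Tendsto (fun k => diagProd (f k) σ) atTop (𝓝 (diagProd L σ)) :=
  tendsto_finsetProd _ fun i _ => hL i (σ i)

lemma exists_pos_diag (hM : Admissible M) (hts : TotalSupport M) :
    ∃ σ : Equiv.Perm (Fin n), ∀ i, 0 < M i (σ i) := by
  rcases n with _ | n
  · exact ⟨1, fun i => i.elim0⟩
  · obtain ⟨j, hj⟩ := hM.2.1 0
    obtain ⟨σ, h, _⟩ := hts 0 j (lt_of_le_of_ne (hM.1 0 j) hj.symm)
    exact ⟨σ, h⟩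

lemma cluster_good (hM : Admissible M) (hts : TotalSupport M) {φ : ℕ → ℕ} (hφ : StrictMono φ)
    {L : Matrix (Fin n) (Fin n) ℝ} (hL : EntrywiseLimit (fun k => skL M (φ k)) L) :
    DE M L ∧ DoublyStochastic L := by
  have hpos : ∀ i j, 0 < M i j → 0 < L i j := by
    intro i j hij
    obtain ⟨δ, hδ, h⟩ := skL_lower hM hts i j
    exact hδ.trans_le (ge_of_tendsto' (hL i j) fun k => h _ hij)
  have hDE : DE M L := DE.limit hM (fun k => DE.skL hM (φ k)) hL hpos
  have hrow : ∀ i, ∑ j, L i j = 1 := by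
    intro i
    refine tendsto_nhds_unique (tendsto_finsetSum _ fun j _ => hL i j) ?_
    simp only [skL_row hM]
    exact tendsto_const_nhds
  refine ⟨hDE, hDE.nonneg hM, hrow, ?_⟩
  obtain ⟨σ, hσ⟩ := exists_pos_diag hM hts
  obtain ⟨a, ha⟩ : ∃ a, Tendsto (fun k => diagProd (skL M k) σ) atTop (𝓝 a) :=
    ⟨_, tendsto_atTop_ciSup (skL_mono hM σ) ⟨1, by
      rintro _ ⟨k, rfl⟩; exact skL_diag_le_one hM k σ⟩⟩
  have hb : Tendsto (fun k => diagProd (skT M k) σ) atTop (𝓝 a) :=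
    tendsto_of_tendsto_of_tendsto_of_le_of_le ha ((tendsto_add_atTop_iff_nat 1).2 ha)
      (fun k => skL_le_skT hM k σ) (fun k => skT_le_skL hM k σ)
  have h1 : diagProd L σ = a := tendsto_nhds_unique (diag_limit hL σ) (ha.comp hφ.tendsto_atTop)
  have h2 : diagProd (colNorm L) σ = a :=
    tendsto_nhds_unique (diag_limit (colNorm_limit hL (hDE.col_pos hM)) σ)
      (hb.comp hφ.tendsto_atTop)
  have hap : 0 < diagProd L σ := Finset.prod_pos fun i _ => hpos _ _ (hσ i)
  rw [diag_colNorm, ← h1] at h2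
  have hcp : 0 < ∏ j, ∑ i, L i j := Finset.prod_pos fun j _ => hDE.col_pos hM j
  rw [div_eq_iff hcp.ne'] at h2
  have h3 : ∏ j, ∑ i, L i j = 1 := by
    have : diagProd L σ * (∏ j, ∑ i, L i j) = diagProd L σ * 1 := by rw [mul_one]; exact h2.symm
    exact mul_left_cancel₀ hap.ne' this
  refine (prod_aux _ (hDE.col_pos hM) ?_).2 h3.ge
  rw [Finset.sum_comm]; simp [hrow]

lemma entrywise_iff {f : ℕ → Matrix (Fin n) (Fin n) ℝ} {L : Matrix (Fin n) (Fin n) ℝ} :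
    EntrywiseLimit f L ↔ Tendsto f atTop (𝓝 L) := by
  unfold EntrywiseLimit
  refine Iff.trans ?_ tendsto_pi_nhds.symm
  exact forall_congr' fun i => tendsto_pi_nhds.symm

end

/-- For an admissible square matrix M with total support, the Sinkhorn
iteration converges to a doubly stochastic matrix M*, and M = X M* Y for some diagonal
matrices X, Y with positive diagonal entries. -/
theorem totalSupport_sinkhorn_diag_equiv (n : ℕ) (M : Matrix (Fin n) (Fin n) ℝ)
    (hM : Admissible M) (hts : TotalSupport M) :
    ∃ Mstar : Matrix (Fin n) (Fin n) ℝ, DoublyStochastic Mstar ∧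
      EntrywiseLimit (skL M) Mstar ∧ EntrywiseLimit (skT M) Mstar ∧
      ∃ (x y : Fin n → ℝ), (∀ i, 0 < x i) ∧ (∀ j, 0 < y j) ∧
        M = Matrix.diagonal x * Mstar * Matrix.diagonal y := by
  let K : Set (Matrix (Fin n) (Fin n) ℝ) :=
    Set.pi Set.univ fun _ => Set.pi Set.univ fun _ => Set.Icc (0:ℝ) 1
  have hK : IsCompact K :=
    isCompact_univ_pi fun _ => isCompact_univ_pi fun _ => isCompact_Icc
  have hmem : ∀ k, skL M k ∈ K := fun k i _ j _ =>
    ⟨(DE.skL hM k).nonneg hM i j, skL_le_one_s19 hM k i j⟩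
  haveI : FirstCountableTopology (Matrix (Fin n) (Fin n) ℝ) :=
    inferInstanceAs (FirstCountableTopology (Fin n → Fin n → ℝ))
  obtain ⟨L, -, φ, hφ, hL⟩ := hK.tendsto_subseq hmem
  obtain ⟨hDE, hds⟩ := cluster_good hM hts hφ (entrywise_iff.2 hL)
  have hlim : Tendsto (skL M) atTop (𝓝 L) := by
    refine hK.tendsto_nhds_of_unique_mapClusterPt (Eventually.of_forall hmem) ?_
    intro L' _ hL'
    obtain ⟨ψ, hψ, hψL⟩ := TopologicalSpace.FirstCountableTopology.tendsto_subseq hL'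
    obtain ⟨hDE', hds'⟩ := cluster_good hM hts hψ (entrywise_iff.2 hψL)
    exact hDE.unique hDE' hds hds'
  have hlimE := entrywise_iff.2 hlim
  refine ⟨L, hds, hlimE, ?_, ?_⟩
  · have h := colNorm_limit hlimE (hDE.col_pos hM)
    have hc : colNorm L = L := by
      ext i j
      simp [colNorm, hds.2.2]
    rw [hc] at h
    exact h
  · obtain ⟨u, v, h⟩ := hDE
    refine ⟨fun i => Real.exp (-u i), fun j => Real.exp (-v j), fun _ => Real.exp_pos _,
      fun _ => Real.exp_pos _, ?_⟩
    ext i j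
    rw [Matrix.mul_diagonal, Matrix.diagonal_mul, h, Real.exp_neg, Real.exp_neg]
    field_simp
end
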